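/- arXiv:2604.24828 — 2 statements merged into one kernel-verified Lean document; each statement's English description precedes it below -/
import Mathlib

section
/- Every natural number N can be written as a sum of at most three triangular numbers, i.e., there exist a, b, c ≥ 0 with N = a(a+1)/2 + b(b+1)/2 + c(c+1)/2. -/
/-- Every residue class modulo a positive `p` has a representative in `[-p / 2, p / 2]`. -/
theorem exists_abs_two_mul_add_mul_le {p : ℤ} (hp : 0 < p) (q : ℤ) :
    ∃ k : ℤ, |2 * (q + k * p)| ≤ p := by
  refine ⟨-((2 * q + p) / (2 * p)), abs_le.2 ?_⟩
  have h₁ := Int.mul_ediv_add_emod (2 * q + p) (2 * p)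
  have h₂ := Int.emod_nonneg (2 * q + p) (b := 2 * p) (by lia)
  have h₃ := Int.emod_lt_of_pos (2 * q + p) (b := 2 * p) (by lia)
  constructor <;> linarith

/-- A positive definite binary form `p y² + 2 q y z + r z²` takes, at the first column of some
matrix in `SL₂(ℤ)`, a positive value whose square is at most `4 / 3` of its determinant. -/
theorem exists_binaryForm_sq_le (p q r : ℤ) (hp : 0 < p) (hd : 0 < p * r - q ^ 2) :
    ∃ s t u v : ℤ, s * v - t * u = 1 ∧ 0 < p * s ^ 2 + 2 * q * s * u + r * u ^ 2 ∧
      3 * (p * s ^ 2 + 2 * q * s * u + r * u ^ 2) ^ 2 ≤ 4 * (p * r - q ^ 2) := by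
  induction hn : p.toNat using Nat.strong_induction_on generalizing p q r with
  | _ n ih =>
    obtain ⟨k, hk⟩ := exists_abs_two_mul_add_mul_le hp q
    set q' := q + k * p with hq'
    set r' := r + 2 * k * q + k ^ 2 * p with hr'
    have hdet : p * r' - q' ^ 2 = p * r - q ^ 2 := by rw [hq', hr']; ring
    have hsq : 4 * q' ^ 2 ≤ p ^ 2 := by
      have := sq_le_sq' (abs_le.1 hk).1 (abs_le.1 hk).2
      linarith
    by_cases hpr : p ≤ r'
    · refine ⟨1, 0, 0, 1, by norm_num, by simpa using hp, ?_⟩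
      have := mul_le_mul_of_nonneg_left hpr hp.le
      rw [← hdet]
      linarith
    · have hr'pos : 0 < r' := by
        refine pos_of_mul_pos_right (a := p) ?_ hp.le
        linarith [sq_nonneg q']
      obtain ⟨s, t, u, v, h₁, h₂, h₃⟩ := ih r'.toNat (by lia) r' (-q') p hr'pos
        (by linarith) rfl
      have hval : p * (-u + k * s) ^ 2 + 2 * q * (-u + k * s) * s + r * s ^ 2
          = r' * s ^ 2 + 2 * (-q') * s * u + p * u ^ 2 := by rw [hq', hr']; ring
      refine ⟨-u + k * s, -v + k * t, s, t, by linarith, by rwa [hval], ?_⟩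
      rw [hval]
      linarith

/-- The ternary quadratic form with diagonal coefficients `a`, `b`, `c` and off-diagonal matrix
entries `e` (for `yz`), `f` (for `xz`), `h` (for `xy`). -/
def ternaryForm (a b c e f h x y z : ℤ) : ℤ :=
  a * x ^ 2 + b * y ^ 2 + c * z ^ 2 + 2 * e * y * z + 2 * f * x * z + 2 * h * x * y

/-- Every positive definite ternary form is equivalent to one with `2 |h| ≤ a` and
`3 (a b - h²)² ≤ 4 a det`, with the same `a`. -/
theorem exists_ternaryForm_reduced (a b c e f h : ℤ) (ha : 0 < a) (hab : 0 < a * b - h ^ 2)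
    (hdet : a * b * c + 2 * e * f * h - a * e ^ 2 - b * f ^ 2 - c * h ^ 2 = 1) :
    ∃ b' c' e' f' h' : ℤ, 0 < a * b' - h' ^ 2 ∧
      a * b' * c' + 2 * e' * f' * h' - a * e' ^ 2 - b' * f' ^ 2 - c' * h' ^ 2 = 1 ∧
      |2 * h'| ≤ a ∧ 3 * (a * b' - h' ^ 2) ^ 2 ≤ 4 * a ∧
      ∀ x y z, ∃ x' y' z',
        ternaryForm a b c e f h x y z = ternaryForm a b' c' e' f' h' x' y' z' := by
  have hg : (a * b - h ^ 2) * (a * c - f ^ 2) - (a * e - f * h) ^ 2 = a := by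
    linear_combination a * hdet
  obtain ⟨s, t, u, v, h₁, h₂, h₃⟩ := exists_binaryForm_sq_le (a * b - h ^ 2) (a * e - f * h)
    (a * c - f ^ 2) hab (by rwa [hg])
  rw [hg] at h₃
  obtain ⟨k, hk⟩ := exists_abs_two_mul_add_mul_le ha (h * s + f * u)
  set b₁ := b * s ^ 2 + 2 * e * s * u + c * u ^ 2 with hb₁
  set e₁ := b * s * t + e * (s * v + t * u) + c * u * v with he₁
  set c₁ := b * t ^ 2 + 2 * e * t * v + c * v ^ 2 with hc₁
  set h' := h * s + f * u + k * a with hh'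
  set f₁ := h * t + f * v with hf₁
  have hminor : a * (b₁ + 2 * k * (h * s + f * u) + k ^ 2 * a) - h' ^ 2 =
      (a * b - h ^ 2) * s ^ 2 + 2 * (a * e - f * h) * s * u + (a * c - f ^ 2) * u ^ 2 := by
    rw [hb₁, hh']; ring
  refine ⟨b₁ + 2 * k * (h * s + f * u) + k ^ 2 * a, c₁, e₁ + k * f₁, f₁, h', by rwa [hminor], ?_,
    hk, by rwa [hminor], fun x y z ↦
      ⟨x - k * (v * y - t * z), v * y - t * z, -u * y + s * z, ?_⟩⟩
  · have : a * (b₁ + 2 * k * (h * s + f * u) + k ^ 2 * a) * c₁ + 2 * (e₁ + k * f₁) * f₁ * h'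
        - a * (e₁ + k * f₁) ^ 2 - (b₁ + 2 * k * (h * s + f * u) + k ^ 2 * a) * f₁ ^ 2
        - c₁ * h' ^ 2 =
        (a * b * c + 2 * e * f * h - a * e ^ 2 - b * f ^ 2 - c * h ^ 2)
          * (s * v - t * u) ^ 2 := by
      rw [hb₁, hc₁, he₁, hf₁, hh']; ring
    rw [this, hdet, h₁]; norm_num
  · have hsubst : ∀ X Y Z : ℤ, ternaryForm a (b₁ + 2 * k * (h * s + f * u) + k ^ 2 * a) c₁
        (e₁ + k * f₁) f₁ h' X Y Z =
        ternaryForm a b c e f h (X + k * Y) (s * Y + t * Z) (u * Y + v * Z) := by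
      intro X Y Z
      rw [hb₁, hc₁, he₁, hf₁, hh', ternaryForm, ternaryForm]; ring
    rw [hsubst]
    congr 1
    · ring
    · linear_combination -y * h₁
    · linear_combination -z * h₁

/-- A positive definite ternary integral form of determinant one only takes values that are sums of
three squares. -/
theorem ternaryForm_eq_sum_three_sq (a b c e f h : ℤ) (ha : 0 < a) (hab : 0 < a * b - h ^ 2)
    (hdet : a * b * c + 2 * e * f * h - a * e ^ 2 - b * f ^ 2 - c * h ^ 2 = 1) (x y z : ℤ) :
    ∃ u v w : ℤ, ternaryForm a b c e f h x y z = u ^ 2 + v ^ 2 + w ^ 2 := by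
  induction hn : a.toNat using Nat.strong_induction_on generalizing a b c e f h x y z with
  | _ n ih =>
    obtain ⟨b', c', e', f', h', hab', hdet', hh', hred, hval⟩ :=
      exists_ternaryForm_reduced a b c e f h ha hab hdet
    obtain ⟨X, Y, Z, hXYZ⟩ := hval x y z
    rw [hXYZ]
    have hsq : 4 * h' ^ 2 ≤ a ^ 2 := by
      have := sq_le_sq' (abs_le.1 hh').1 (abs_le.1 hh').2
      linarith
    have hb' : 0 < b' := by
      refine pos_of_mul_pos_right (a := a) ?_ ha.le
      linarith [sq_nonneg h']
    obtain rfl | ha2 : a = 1 ∨ 2 ≤ a := by lia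
    · obtain rfl : h' = 0 := by have := abs_le.1 hh'; lia
      obtain rfl : b' = 1 := by nlinarith
      obtain rfl : c' = 1 + e' ^ 2 + f' ^ 2 := by linarith
      exact ⟨X + f' * Z, Y + e' * Z, Z, by rw [ternaryForm]; ring⟩
    · have hlt : b' < a := by
        by_contra! hle
        have h₁ : 3 * a ^ 2 ≤ 4 * (a * b' - h' ^ 2) := by nlinarith
        have h₂ : (3 * a ^ 2) ^ 2 ≤ (4 * (a * b' - h' ^ 2)) ^ 2 :=
          pow_le_pow_left₀ (by positivity) h₁ 2
        have h₃ : a * (27 * a ^ 3) ≤ a * 64 := by linarith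
        have h₄ : (2 : ℤ) ^ 3 ≤ a ^ 3 := pow_le_pow_left₀ (by norm_num) ha2 3
        linarith [le_of_mul_le_mul_left h₃ ha]
      obtain ⟨u, v, w, huvw⟩ := ih b'.toNat (by lia) b' a c' f' e' h' hb' (by linarith)
        (by linarith) Y X Z rfl
      exact ⟨u, v, w, by rw [← huvw, ternaryForm, ternaryForm]; ring⟩

/-- If `-d` is a square modulo `d n - 1`, then `n` is a sum of three squares. -/
theorem sum_three_sq_of_dvd_sq_add {n d x : ℤ} (hd : 0 < d) (hm : 0 < d * n - 1)
    (hx : d * n - 1 ∣ x ^ 2 + d) : ∃ u v w : ℤ, n = u ^ 2 + v ^ 2 + w ^ 2 := by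
  obtain ⟨a, ha⟩ := hx
  have hapos : 0 < a := by
    refine pos_of_mul_pos_right (a := d * n - 1) ?_ hm.le
    rw [← ha]; positivity
  obtain ⟨u, v, w, h⟩ := ternaryForm_eq_sum_three_sq a (d * n - 1) n 0 1 x hapos
    (by linarith) (by linear_combination (-n) * ha) 0 0 1
  exact ⟨u, v, w, by rw [← h, ternaryForm]; ring⟩

open NumberTheorySymbols in
/-- A natural number congruent to `3` modulo `8` is a sum of three squares. -/
theorem sum_three_sq_of_eight_mul_add_three (N : ℕ) :
    ∃ u v w : ℤ, (8 * N + 3 : ℤ) = u ^ 2 + v ^ 2 + w ^ 2 := by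
  have hcop : (4 * N + 1).Coprime (4 * (8 * N + 3)) := by
    refine Nat.isCoprime_iff_coprime.1 ?_
    push_cast
    exact IsCoprime.mul_right ⟨1, -N, by ring⟩ ⟨-2, 1, by ring⟩
  obtain ⟨p, hlt, hp, hmod⟩ := Nat.forall_exists_prime_gt_and_modEq (4 * N + 1) (by lia) hcop
  obtain ⟨j, hj⟩ := (Nat.modEq_iff_dvd' hlt.le).1 hmod.symm
  have hpj : p = 4 * N + 1 + 4 * (8 * N + 3) * j := by lia
  have hp4 : p % 4 = 1 := by
    rw [hpj, mul_assoc]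
    lia
  have hpodd : Odd p := Nat.odd_iff.2 (by lia)
  have hdodd : Odd (8 * j + 1) := Nat.odd_iff.2 (by lia)
  have h2p : (2 * p : ℤ) = (8 * j + 1) * (8 * N + 3) - 1 := by rw [hpj]; push_cast; ring
  have hneg : J(-1 | 8 * j + 1) = 1 := by
    rw [jacobiSym.at_neg_one hdodd, ZMod.χ₄_nat_one_mod_four (by lia)]
  have htwo : J(2 | 8 * j + 1) = 1 := by
    rw [jacobiSym.at_two hdodd, ZMod.χ₈_nat_eq_if_mod_eight, if_neg (by lia),
      if_pos (by lia)]
  have hpd : J(p | 8 * j + 1) = 1 := by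
    have h : J(2 * p | 8 * j + 1) = J(-1 | 8 * j + 1) := by
      refine jacobiSym.mod_left' (Int.ModEq.symm (Int.modEq_iff_dvd.2 ⟨8 * N + 3, ?_⟩))
      push_cast
      linarith
    rwa [jacobiSym.mul_left, htwo, hneg, one_mul] at h
  have hdp : J(-(8 * j + 1 : ℕ) | p) = 1 := by
    rw [jacobiSym.neg _ hpodd, ZMod.χ₄_nat_one_mod_four hp4, one_mul,
      ← jacobiSym.quadratic_reciprocity_one_mod_four hp4 hdodd, hpd]
  have : Fact p.Prime := ⟨hp⟩
  obtain ⟨y, hy⟩ := ZMod.isSquare_of_jacobiSym_eq_one hdp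
  obtain ⟨x, rfl⟩ := ZMod.intCast_surjective y
  have hdvd : (p : ℤ) ∣ x ^ 2 + (8 * j + 1) := by
    rw [← ZMod.intCast_zmod_eq_zero_iff_dvd]
    push_cast at hy ⊢
    linear_combination -hy
  obtain ⟨x', hx', hodd⟩ : ∃ x' : ℤ, (p : ℤ) ∣ x' ^ 2 + (8 * j + 1) ∧ Odd x' := by
    rcases Int.even_or_odd x with hx | hx
    · refine ⟨x + p, ?_, hx.add_odd (by exact_mod_cast hpodd)⟩
      rw [show (x + p) ^ 2 + (8 * j + 1) = x ^ 2 + (8 * j + 1) + p * (2 * x + p) by ring]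
      exact dvd_add hdvd (dvd_mul_right _ _)
    · exact ⟨x, hdvd, hx⟩
  have htwo_dvd : (2 : ℤ) ∣ x' ^ 2 + (8 * j + 1) :=
    even_iff_two_dvd.1 (hodd.pow.add_odd (by exact_mod_cast hdodd))
  have hcop2 : IsCoprime (2 : ℤ) p :=
    Nat.isCoprime_iff_coprime.2 (Nat.coprime_two_left.2 hpodd)
  refine sum_three_sq_of_dvd_sq_add (d := 8 * j + 1) (x := x') (by positivity) ?_ ?_
  · rw [← h2p]
    exact_mod_cast Nat.mul_pos two_pos hp.pos
  · rw [← h2p]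
    exact hcop2.mul_dvd htwo_dvd hx'

/-- If three squares sum to `3` modulo `8`, all three are odd. -/
theorem odd_of_sum_three_sq {N u v w : ℤ} (h : 8 * N + 3 = u ^ 2 + v ^ 2 + w ^ 2) :
    Odd u ∧ Odd v ∧ Odd w := by
  have key : ∀ a b c : ZMod 8, 3 = a ^ 2 + b ^ 2 + c ^ 2 →
      a.val % 2 = 1 ∧ b.val % 2 = 1 ∧ c.val % 2 = 1 := by decide
  have hcast : (3 : ZMod 8) = (u : ZMod 8) ^ 2 + (v : ZMod 8) ^ 2 + (w : ZMod 8) ^ 2 := by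
    have h8 : (8 : ZMod 8) = 0 := rfl
    have := congrArg (Int.cast : ℤ → ZMod 8) h
    push_cast at this
    rwa [h8, zero_mul, zero_add] at this
  have hval : ∀ a : ℤ, (a : ZMod 8).val % 2 = 1 → Odd a := fun a ha ↦ by
    have := ZMod.val_intCast (n := 8) a
    exact Int.odd_iff.2 (by lia)
  obtain ⟨hu, hv, hw⟩ := key _ _ _ hcast
  exact ⟨hval u hu, hval v hv, hval w hw⟩

/-- The square of an odd integer is `8 T + 1` for a triangular number `T`. -/
theorem Odd.exists_sq_eq_eight_mul_triangular_add_one {u : ℤ} (hu : Odd u) :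
    ∃ a : ℕ, u ^ 2 = 8 * ((a * (a + 1) / 2 : ℕ) : ℤ) + 1 := by
  obtain ⟨a, ha⟩ := Int.natAbs_odd.2 hu
  refine ⟨a, ?_⟩
  have htri : 2 * (a * (a + 1) / 2) = a * (a + 1) :=
    Nat.mul_div_cancel' (Nat.even_mul_succ_self a).two_dvd
  rw [← Int.natAbs_sq, ha]
  zify at htri
  push_cast
  linarith

theorem stmt_6 (N : ℕ) :
    ∃ a b c : ℕ, N = a * (a + 1) / 2 + b * (b + 1) / 2 + c * (c + 1) / 2 := by
  obtain ⟨u, v, w, h⟩ := sum_three_sq_of_eight_mul_add_three N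
  obtain ⟨hu, hv, hw⟩ := odd_of_sum_three_sq h
  obtain ⟨a, ha⟩ := hu.exists_sq_eq_eight_mul_triangular_add_one
  obtain ⟨b, hb⟩ := hv.exists_sq_eq_eight_mul_triangular_add_one
  obtain ⟨c, hc⟩ := hw.exists_sq_eq_eight_mul_triangular_add_one
  exact ⟨a, b, c, by lia⟩
end

section
/- Every sufficiently large natural number N can be written as a sum of at most seven binomial coefficients of the form C(n, 3) with n ≥ 3. -/
open Filter

/-- A positive definite integral ternary form of determinant `1` is the Gram matrix of an
integral basis of `ℤ³`. -/
theorem exists_gram_of_det_one (A G : ℕ) : ∀ a b c d e f : ℤ, a = A → a * b - f ^ 2 = G → 0 < a →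
    0 < a * b - f ^ 2 → a * b * c + 2 * d * e * f - a * d ^ 2 - b * e ^ 2 - c * f ^ 2 = 1 →
    ∃ u₁ u₂ u₃ v₁ v₂ v₃ w₁ w₂ w₃ : ℤ,
      u₁ * u₁ + u₂ * u₂ + u₃ * u₃ = a ∧ v₁ * v₁ + v₂ * v₂ + v₃ * v₃ = b ∧
      w₁ * w₁ + w₂ * w₂ + w₃ * w₃ = c ∧ v₁ * w₁ + v₂ * w₂ + v₃ * w₃ = d ∧
      u₁ * w₁ + u₂ * w₂ + u₃ * w₃ = e ∧ u₁ * v₁ + u₂ * v₂ + u₃ * v₃ = f := by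
  induction A using Nat.strong_induction_on generalizing G with
  | _ A ihA =>
  induction G using Nat.strong_induction_on with
  | _ G ihG =>
  intro a b c d e f hA hG ha hg hdet
  have near : ∀ x y : ℤ, 0 < y → ∃ k : ℤ, 2 * (x + k * y) ≤ y ∧ -y ≤ 2 * (x + k * y) := by
    intro x y hy
    refine ⟨-((2 * x + y) / (2 * y)), ?_, ?_⟩ <;>
    have h1 := Int.emod_add_mul_ediv (2 * x + y) (2 * y) <;>
    have h2 := Int.emod_nonneg (2 * x + y) (by omega : 2 * y ≠ 0) <;>
    have h3 := Int.emod_lt_of_pos (2 * x + y) (by omega : 0 < 2 * y) <;> nlinarith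
  obtain ⟨k, hk1, hk2⟩ := near (a * d - e * f) (a * b - f ^ 2) hg
  obtain ⟨l, hl1, hl2⟩ := near f a ha
  have key : (a * b - f ^ 2) * (a * (c + 2 * k * d + k ^ 2 * b) - (e + k * f) ^ 2)
      - (a * d - e * f + k * (a * b - f ^ 2)) ^ 2 = a := by linear_combination a * hdet
  by_cases h1 : a * (c + 2 * k * d + k ^ 2 * b) - (e + k * f) ^ 2 < a * b - f ^ 2
  · have hpos : 0 < a * (c + 2 * k * d + k ^ 2 * b) - (e + k * f) ^ 2 := by
      by_contra hcon
      nlinarith [sq_nonneg (a * d - e * f + k * (a * b - f ^ 2))]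
    obtain ⟨u₁, u₂, u₃, v₁, v₂, v₃, w₁, w₂, w₃, h⟩ :=
      ihG (a * (c + 2 * k * d + k ^ 2 * b) - (e + k * f) ^ 2).toNat (by omega) a
        (c + 2 * k * d + k ^ 2 * b) b (d + k * b) f (e + k * f) hA (by omega) ha hpos
        (by linear_combination hdet)
    obtain ⟨h1, h2, h3, h4, h5, h6⟩ := h
    refine ⟨u₁, u₂, u₃, w₁, w₂, w₃, v₁ - k * w₁, v₂ - k * w₂, v₃ - k * w₃, h1, h3, ?_, ?_, ?_, h5⟩
    · linear_combination h2 - 2 * k * h4 + k ^ 2 * h3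
    · linear_combination h4 - k * h3
    · linear_combination h6 - k * h5
  by_cases h2 : b + 2 * l * f + l ^ 2 * a < a
  · have hpos : 0 < b + 2 * l * f + l ^ 2 * a := by
      by_contra hcon
      nlinarith [sq_nonneg (f + l * a)]
    obtain ⟨u₁, u₂, u₃, v₁, v₂, v₃, w₁, w₂, w₃, h⟩ :=
      ihA (b + 2 * l * f + l ^ 2 * a).toNat (by omega) G (b + 2 * l * f + l ^ 2 * a) a c e
        (d + l * e) (f + l * a) (by omega) (by linear_combination hG) hpos
        (by linear_combination hg) (by linear_combination hdet)
    obtain ⟨h1, h2, h3, h4, h5, h6⟩ := h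
    refine ⟨v₁, v₂, v₃, u₁ - l * v₁, u₂ - l * v₂, u₃ - l * v₃, w₁, w₂, w₃, h2, ?_, h3, ?_, h4, ?_⟩
    · linear_combination h1 - 2 * l * h6 + l ^ 2 * h2
    · linear_combination h5 - l * h4
    · linear_combination h6 - l * h2
  have hg2 : 3 * (a * b - f ^ 2) ^ 2 ≤ 4 * a := by nlinarith
  have ha2 : 3 * a ^ 2 ≤ 4 * (a * b - f ^ 2) := by nlinarith
  have ha1 : a = 1 := by
    by_contra hne
    have h2a : 2 ≤ a := by omega
    have : (3 * a ^ 2) ^ 2 ≤ (4 * (a * b - f ^ 2)) ^ 2 := by gcongr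
    nlinarith [pow_pos ha 3, mul_pos ha ha, mul_le_mul h2a h2a (by norm_num) (by omega)]
  subst ha1
  have hb1 : 1 * b - f ^ 2 = 1 := by nlinarith
  have hl0 : f + l * 1 = 0 := by omega
  rw [hb1] at hk1 hk2
  have hk0 : 1 * d - e * f + k * 1 = 0 := by omega
  refine ⟨1, 0, 0, f, 1, 0, e, d - e * f, 1, by ring, by linear_combination -hb1, ?_, by ring,
    by ring, by ring⟩
  linear_combination -hdet + (c - e ^ 2) * hb1

theorem exists_sum_three_squares {n : ℕ} (hn : n % 4 = 2) :
    ∃ x y z : ℤ, x * x + y * y + z * z = n := by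
  have hcop : Nat.Coprime (n - 1) (4 * n) := by
    refine Nat.Coprime.mul_right ?_ ?_
    · have : Odd (n - 1) := by rw [Nat.odd_iff]; omega
      exact (Nat.coprime_two_right.mpr this).pow_right 2
    · rw [Nat.coprime_comm]
      exact (Nat.coprime_self_sub_right (by omega)).mpr (Nat.coprime_one_right n)
  obtain ⟨p, hpn, hp, hmod⟩ := Nat.forall_exists_prime_gt_and_modEq n (by omega) hcop
  obtain ⟨j, hj⟩ : ∃ j, p = 4 * n * j + (n - 1) := by
    refine ⟨p / (4 * n), ?_⟩
    have h := Nat.div_add_mod p (4 * n)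
    have h2 : p % (4 * n) = n - 1 := by
      rw [hmod, Nat.mod_eq_of_lt]; omega
    omega
  have hpd : p + 1 = (4 * j + 1) * n := by
    have : p + 1 = 4 * n * j + n := by omega
    rw [this]; ring
  have hp4 : p % 4 = 1 := by
    have : 4 * n * j = 4 * (n * j) := by ring
    omega
  have := Fact.mk hp
  have hdo : Odd (4 * j + 1) := ⟨2 * j, by ring⟩
  have hpo : Odd p := by rw [Nat.odd_iff]; omega
  have hJ : jacobiSym (-((4 * j + 1 : ℕ) : ℤ)) p = 1 := by
    rw [jacobiSym.neg _ hpo, ZMod.χ₄_nat_one_mod_four hp4, one_mul,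
      jacobiSym.quadratic_reciprocity_one_mod_four (by omega) hpo]
    have : ((p : ℤ)) % ((4 * j + 1 : ℕ) : ℤ) = (-1) % ((4 * j + 1 : ℕ) : ℤ) := by
      refine (Int.modEq_iff_dvd (a := (p : ℤ)) (b := -1)).2 ⟨-n, ?_⟩
      have hz : (p : ℤ) + 1 = ((4 * j + 1 : ℕ) : ℤ) * n := by exact_mod_cast hpd
      linear_combination -hz
    rw [jacobiSym.mod_left' this, jacobiSym.at_neg_one hdo, ZMod.χ₄_nat_one_mod_four (by omega)]
  have hsq := ZMod.isSquare_of_jacobiSym_eq_one hJ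
  obtain ⟨r, hr⟩ := hsq
  obtain ⟨x, rfl⟩ := ZMod.intCast_surjective r
  have hdvd : (p : ℤ) ∣ x ^ 2 + ((4 * j + 1 : ℕ) : ℤ) := by
    rw [← ZMod.intCast_zmod_eq_zero_iff_dvd]
    push_cast at hr ⊢
    linear_combination -hr
  obtain ⟨a, ha⟩ := hdvd
  have hp0 : (0 : ℤ) < p := by exact_mod_cast hp.pos
  have ha0 : 0 < a := by
    by_contra hcon
    push_cast at ha
    nlinarith [sq_nonneg x]
  have hdz : (p : ℤ) + 1 = (4 * j + 1) * n := by exact_mod_cast hpd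
  push_cast at ha
  have hg : a * p - x ^ 2 = 4 * j + 1 := by linear_combination -ha
  obtain ⟨u₁, u₂, u₃, v₁, v₂, v₃, w₁, w₂, w₃, h⟩ := exists_gram_of_det_one a.toNat (4 * j + 1)
    a p n 0 1 x (by omega) (by rw [hg]; push_cast; ring) ha0 (by rw [hg]; positivity)
    (by linear_combination (n : ℤ) * hg - hdz)
  exact ⟨w₁, w₂, w₃, h.2.2.1⟩

theorem exists_sq_add_sq_add_two_mul_sq {R : ℕ} (hR : R % 2 = 1) :
    ∃ x y z : ℤ, x ^ 2 + y ^ 2 + 2 * z ^ 2 = R := by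
  obtain ⟨a, b, c, h⟩ := exists_sum_three_squares (n := 2 * R) (by omega)
  push_cast at h
  have main : ∀ a b c : ℤ, a * a + b * b + c * c = 2 * R → 2 ∣ a - b → 2 ∣ c →
      ∃ x y z : ℤ, x ^ 2 + y ^ 2 + 2 * z ^ 2 = R := by
    rintro a b c h ⟨x, hx⟩ ⟨z, rfl⟩
    obtain rfl : a = b + 2 * x := by linarith
    exact ⟨b + x, x, z, by linarith⟩
  have hmod : (a * a + b * b + c * c) % 4 = 2 := by rw [h]; omega
  have e : ∀ x : ℤ, x * x % 4 = 0 ∧ x % 2 = 0 ∨ x * x % 4 = 1 ∧ x % 2 = 1 := by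
    intro x
    have : x % 4 = 0 ∨ x % 4 = 1 ∨ x % 4 = 2 ∨ x % 4 = 3 := by omega
    rcases this with h | h | h | h <;> simp [Int.mul_emod, h] <;> omega
  rcases e a with ha | ha <;> rcases e b with hb | hb <;> rcases e c with hc | hc <;>
    first
    | omega
    | exact main a b c h (by omega) (by omega)
    | exact main a c b (by linarith) (by omega) (by omega)
    | exact main b c a (by linarith) (by omega) (by omega)

/-- The tetrahedral polynomial `(x³ - x) / 6`, an odd function with `tet n = C(n + 1, 3)`. -/
def tet (x : ℤ) : ℤ := (x ^ 3 - x) / 6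

theorem six_mul_tet (x : ℤ) : 6 * tet x = x ^ 3 - x := by
  refine Int.mul_ediv_cancel' ?_
  have h : x % 6 = 0 ∨ x % 6 = 1 ∨ x % 6 = 2 ∨ x % 6 = 3 ∨ x % 6 = 4 ∨ x % 6 = 5 := by omega
  apply Int.dvd_of_emod_eq_zero
  rcases h with h | h | h | h | h | h <;> simp [Int.sub_emod, pow_succ, Int.mul_emod, h]

theorem tet_add_add_tet_sub (b u : ℤ) : tet (b + u) + tet (b - u) = 2 * tet b + b * u ^ 2 := by
  have h1 := six_mul_tet (b + u)
  have h2 := six_mul_tet (b - u)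
  have h3 := six_mul_tet b
  have : 6 * (tet (b + u) + tet (b - u)) = 6 * (2 * tet b + b * u ^ 2) := by
    linear_combination h1 + h2 - 2 * h3
  linarith

theorem choose_succ_three (n : ℕ) : (((n + 1).choose 3 : ℕ) : ℤ) = tet n := by
  have h := six_mul_tet n
  have h2 := Nat.descFactorial_eq_factorial_mul_choose (n + 1) 3
  have h3 : (((n + 1).descFactorial 3 : ℕ) : ℤ) = (n : ℤ) ^ 3 - n := by
    rcases n with _ | _ | n
    · simp [Nat.descFactorial]
    · simp [Nat.descFactorial]
    · simp [Nat.descFactorial]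
      ring
  have h4 : (((n + 1).descFactorial 3 : ℕ) : ℤ) = 6 * ((n + 1).choose 3 : ℕ) := by
    rw [h2]; push_cast; simp [Nat.factorial]
  linarith

/-- `N` is a sum of seven values of `tet` at nonnegative integers. -/
def IsSumSevenTet (N : ℤ) : Prop :=
  ∃ l : List ℤ, l.length = 7 ∧ (∀ x ∈ l, 0 ≤ x) ∧ N = (l.map tet).sum

theorem IsSumSevenTet.exists_list {N : ℕ} (h : IsSumSevenTet N) :
    ∃ l : List ℕ, l.length ≤ 7 ∧ (∀ n ∈ l, 3 ≤ n) ∧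
      N = (l.map (fun n => n.choose 3)).sum := by
  obtain ⟨l, hlen, hpos, hsum⟩ := h
  refine ⟨(l.map fun x => x.toNat + 1).filter (3 ≤ ·), ?_, ?_, ?_⟩
  · refine (List.length_filter_le _ _).trans ?_
    simp [hlen]
  · intro n hn
    simpa using (List.mem_filter.mp hn).2
  · have key : ∀ l : List ℤ, (∀ x ∈ l, 0 ≤ x) →
        (l.map tet).sum =
          ((((l.map fun x => x.toNat + 1).filter (3 ≤ ·)).map (fun n => n.choose 3)).sum : ℕ) := by
      intro l
      induction l with
      | nil => simp
      | cons x l ih =>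
        intro hx
        have ih' := ih fun y hy => hx y (List.mem_cons_of_mem _ hy)
        have hx0 : 0 ≤ x := hx x List.mem_cons_self
        have hc := choose_succ_three x.toNat
        rw [Int.toNat_of_nonneg hx0] at hc
        by_cases h3 : 3 ≤ x.toNat + 1
        · rw [List.map_cons, List.map_cons, List.filter_cons_of_pos (by simpa using h3),
            List.map_cons, List.sum_cons, List.sum_cons, ih']
          push_cast
          rw [hc]
        · rw [List.map_cons, List.map_cons, List.filter_cons_of_neg (by simpa using h3),
            List.sum_cons, ih', ← hc, Nat.choose_eq_zero_of_lt (by omega)]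
          simp
    have := key l hpos
    rw [← hsum] at this
    exact_mod_cast this

/-- The form `e₁ x² + e₂ y² + e₃ z²` represents every natural number `≡ r` modulo `w`. -/
def RepresentsClass (e₁ e₂ e₃ w r : ℕ) : Prop :=
  ∀ R : ℕ, R % w = r → ∃ x y z : ℤ, e₁ * x ^ 2 + e₂ * y ^ 2 + e₃ * z ^ 2 = R

theorem RepresentsClass.swap₂₃ {e₁ e₂ e₃ w r : ℕ} (h : RepresentsClass e₁ e₂ e₃ w r) :
    RepresentsClass e₁ e₃ e₂ w r := fun R hR => by
  obtain ⟨x, y, z, h⟩ := h R hR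
  exact ⟨x, z, y, by linarith⟩

theorem RepresentsClass.swap₁₂ {e₁ e₂ e₃ w r : ℕ} (h : RepresentsClass e₁ e₂ e₃ w r) :
    RepresentsClass e₂ e₁ e₃ w r := fun R hR => by
  obtain ⟨x, y, z, h⟩ := h R hR
  exact ⟨y, x, z, by linarith⟩

theorem representsClass_one_one_two : RepresentsClass 1 1 2 2 1 := fun R hR => by
  obtain ⟨x, y, z, h⟩ := exists_sq_add_sq_add_two_mul_sq hR
  exact ⟨x, y, z, by push_cast; linarith⟩

theorem representsClass_one_two_four : RepresentsClass 1 2 4 2 1 := fun R hR => by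
  obtain ⟨x, y, z, h⟩ := exists_sq_add_sq_add_two_mul_sq hR
  rcases Int.even_or_odd' x with ⟨a, rfl | rfl⟩
  · exact ⟨y, z, a, by push_cast; linarith⟩
  rcases Int.even_or_odd' y with ⟨b, rfl | rfl⟩
  · exact ⟨2 * a + 1, z, b, by push_cast; linarith⟩
  exfalso
  ring_nf at h
  omega

theorem representsClass_one_one_four : RepresentsClass 1 1 4 4 2 := fun R hR => by
  obtain ⟨x, y, z, h⟩ := exists_sum_three_squares hR
  rcases Int.even_or_odd' x with ⟨a, rfl | rfl⟩
  · exact ⟨y, z, a, by push_cast; linarith⟩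
  rcases Int.even_or_odd' y with ⟨b, rfl | rfl⟩
  · exact ⟨2 * a + 1, z, b, by push_cast; linarith⟩
  rcases Int.even_or_odd' z with ⟨c, rfl | rfl⟩
  · exact ⟨2 * a + 1, 2 * b + 1, c, by push_cast; linarith⟩
  exfalso
  ring_nf at h
  omega

theorem isSumSevenTet_of_eq {N t b₁ b₂ b₃ c₁ c₂ c₃ M : ℤ} {e₁ e₂ e₃ w r R : ℕ}
    (hform : RepresentsClass e₁ e₂ e₃ w r) (hR : R % w = r) (ht : 0 ≤ t)
    (hb₁ : 0 < b₁) (hb₂ : 0 < b₂) (hb₃ : 0 < b₃) (hM : 0 ≤ M)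
    (h₁ : b₁ * c₁ ^ 2 = e₁ * M) (h₂ : b₂ * c₂ ^ 2 = e₂ * M) (h₃ : b₃ * c₃ ^ 2 = e₃ * M)
    (hl₁ : M * R ≤ b₁ ^ 3) (hl₂ : M * R ≤ b₂ ^ 3) (hl₃ : M * R ≤ b₃ ^ 3)
    (hN : N = tet t + 2 * tet b₁ + 2 * tet b₂ + 2 * tet b₃ + M * R) : IsSumSevenTet N := by
  obtain ⟨x, y, z, hxyz⟩ := hform R hR
  have bound : ∀ b u : ℤ, 0 < b → b * u ^ 2 ≤ b ^ 3 → 0 ≤ b + u ∧ 0 ≤ b - u := by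
    intro b u hb h
    have : u ^ 2 ≤ b ^ 2 := by
      refine le_of_mul_le_mul_left (?_ : b * u ^ 2 ≤ b * b ^ 2) hb
      linarith [show b * b ^ 2 = b ^ 3 by ring]
    have := abs_le_of_sq_le_sq' this hb.le
    constructor <;> linarith
  have e₁' : b₁ * (c₁ * x) ^ 2 = e₁ * M * x ^ 2 := by rw [← h₁]; ring
  have e₂' : b₂ * (c₂ * y) ^ 2 = e₂ * M * y ^ 2 := by rw [← h₂]; ring
  have e₃' : b₃ * (c₃ * z) ^ 2 = e₃ * M * z ^ 2 := by rw [← h₃]; ring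
  have hMR : M * R = e₁ * M * x ^ 2 + e₂ * M * y ^ 2 + e₃ * M * z ^ 2 := by rw [← hxyz]; ring
  have p₁ : 0 ≤ e₁ * M * x ^ 2 := by positivity
  have p₂ : 0 ≤ e₂ * M * y ^ 2 := by positivity
  have p₃ : 0 ≤ e₃ * M * z ^ 2 := by positivity
  obtain ⟨q₁, q₁'⟩ := bound b₁ (c₁ * x) hb₁ (by linarith)
  obtain ⟨q₂, q₂'⟩ := bound b₂ (c₂ * y) hb₂ (by linarith)
  obtain ⟨q₃, q₃'⟩ := bound b₃ (c₃ * z) hb₃ (by linarith)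
  refine ⟨[t, b₁ + c₁ * x, b₁ - c₁ * x, b₂ + c₂ * y, b₂ - c₂ * y, b₃ + c₃ * z, b₃ - c₃ * z],
    rfl, ?_, ?_⟩
  · simp only [List.forall_mem_cons, List.not_mem_nil, false_imp_iff, implies_true, and_true]
    exact ⟨ht, q₁, q₁', q₂, q₂', q₃, q₃'⟩
  simp only [List.map_cons, List.map_nil, List.sum_cons, List.sum_nil]
  linarith [tet_add_add_tet_sub b₁ (c₁ * x), tet_add_add_tet_sub b₂ (c₂ * y),
    tet_add_add_tet_sub b₃ (c₃ * z)]

theorem exists_nat_combination_mem {α β ε : ℝ} (hβ : 0 < β) {p q : ℕ}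
    (h0 : 0 < p * α - q * β) (hε : p * α - q * β < ε) :
    ∀ᶠ Y : ℝ in atTop, ∃ i j : ℕ, Y ≤ i * α + j * β ∧ i * α + j * β ≤ Y + ε := by
  set d := p * α - q * β with hd
  set S := ⌈β / d⌉₊ with hS
  filter_upwards [eventually_ge_atTop ((S * q + 1 : ℕ) * β), eventually_ge_atTop 0] with Y hY hY0
  set J := ⌊Y / β⌋₊ with hJ
  have hJ1 : J * β ≤ Y := by
    rw [← le_div_iff₀ hβ]; exact Nat.floor_le (by positivity)
  have hJ2 : Y < (J + 1) * β := by
    rw [← div_lt_iff₀ hβ]; exact Nat.lt_floor_add_one _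
  have hJS : S * q ≤ J := by
    apply Nat.le_floor
    rw [le_div_iff₀ hβ]
    push_cast at hY ⊢
    nlinarith
  set r := ⌈(Y - J * β) / d⌉₊ with hr
  have hr1 : Y - J * β ≤ r * d := by
    rw [← div_le_iff₀ h0]; exact Nat.le_ceil _
  have hr2 : r * d < Y - J * β + d := by
    have := Nat.ceil_lt_add_one (a := (Y - J * β) / d) (div_nonneg (by linarith) h0.le)
    calc (r : ℝ) * d < ((Y - J * β) / d + 1) * d := by gcongr
      _ = _ := by field_simp
  have hrS : r ≤ S := by
    apply Nat.ceil_le_ceil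
    gcongr
    linarith
  have hrq : r * q ≤ J := (Nat.mul_le_mul_right q hrS).trans hJS
  refine ⟨r * p, J - r * q, ?_, ?_⟩
  · push_cast [hrq]
    nlinarith
  · push_cast [hrq]
    nlinarith

theorem eventually_exists_pow_mul_pow_mem {s K : ℕ} (hs : Odd s) (hs1 : 1 < s) (hK : 0 < K)
    {ρ : ℝ} (hρ : 1 < ρ) :
    ∀ᶠ X : ℝ in atTop, ∀ k₀ < K, ∀ l₀ < K, ∃ i j : ℕ,
      X ≤ ((2 ^ (k₀ + K * i) * s ^ (l₀ + K * j) : ℕ) : ℝ) ^ 3 ∧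
      ((2 ^ (k₀ + K * i) * s ^ (l₀ + K * j) : ℕ) : ℝ) ^ 3 ≤ ρ * X := by
  have hs0 : (1 : ℝ) < s := by exact_mod_cast hs1
  have hl2 : 0 < Real.log 2 := Real.log_pos (by norm_num)
  have hls : 0 < Real.log s := Real.log_pos hs0
  have hKr : (0 : ℝ) < K := by exact_mod_cast hK
  set α := 3 * K * Real.log 2 with hα
  set β := 3 * K * Real.log s with hβ
  have hα0 : 0 < α := by positivity
  have hβ0 : 0 < β := by positivity
  have hirr : Irrational (α / β) := by
    rw [irrational_iff_ne_rational]
    intro a b hb h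
    rw [hα, hβ, mul_div_mul_left _ _ (by positivity), div_eq_div_iff hls.ne' (by exact_mod_cast hb)]
      at h
    have h2 : Real.log ((2 : ℝ) ^ b.natAbs) = Real.log ((s : ℝ) ^ a.natAbs) := by
      rw [Real.log_pow, Real.log_pow, Nat.cast_natAbs, Nat.cast_natAbs]
      push_cast
      have := congrArg abs h
      rw [abs_mul, abs_mul, abs_of_pos hl2, abs_of_pos hls] at this
      linarith
    have h3 := Real.log_injOn_pos (Set.mem_Ioi.mpr (by positivity))
      (Set.mem_Ioi.mpr (by positivity)) h2
    have h4 : 2 ^ b.natAbs = s ^ a.natAbs := by exact_mod_cast h3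
    have h5 : Odd (2 ^ b.natAbs) := h4 ▸ hs.pow
    have h6 : Even (2 ^ b.natAbs) := (even_two).pow_of_ne_zero (Int.natAbs_ne_zero.mpr hb)
    exact (Nat.not_even_iff_odd.mpr h5) h6
  have hlρ : 0 < Real.log ρ := Real.log_pos hρ
  have hdense := dense_addSubgroupClosure_pair_iff.mpr hirr
  obtain ⟨x, hx, hxm⟩ := hdense.exists_mem_open isOpen_Ioo
    (Set.nonempty_Ioo.mpr (lt_min hlρ (lt_min hα0 hβ0)))
  obtain ⟨u, v, huv⟩ := AddSubgroup.mem_closure_pair.mp hx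
  simp only [zsmul_eq_mul] at huv
  have hx0 := hxm.1
  have hx1 : x < Real.log ρ := hxm.2.trans_le (min_le_left _ _)
  have hx2 : x < α := hxm.2.trans_le ((min_le_right _ _).trans (min_le_left _ _))
  have hx3 : x < β := hxm.2.trans_le ((min_le_right _ _).trans (min_le_right _ _))
  have hcomb : ∀ᶠ Y : ℝ in atTop, ∃ i j : ℕ,
      Y ≤ i * α + j * β ∧ i * α + j * β ≤ Y + Real.log ρ := by
    rcases le_or_gt v 0 with hv | hv
    · have hu : 0 ≤ u := by
        by_contra hcon
        have : (u : ℝ) ≤ -1 := by exact_mod_cast (by omega : u ≤ -1)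
        have : (v : ℝ) ≤ 0 := by exact_mod_cast hv
        nlinarith
      lift u to ℕ using hu
      obtain ⟨w, rfl⟩ : ∃ w : ℕ, v = -w := ⟨v.natAbs, by omega⟩
      push_cast at huv
      exact exists_nat_combination_mem hβ0 (p := u) (q := w) (by linarith) (by linarith)
    · have hu : u ≤ 0 := by
        by_contra hcon
        have : (1 : ℝ) ≤ u := by exact_mod_cast (by omega : 1 ≤ u)
        have : (0 : ℝ) < v := by exact_mod_cast hv
        nlinarith
      lift v to ℕ using hv.le
      obtain ⟨w, rfl⟩ : ∃ w : ℕ, u = -w := ⟨u.natAbs, by omega⟩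
      push_cast at huv
      filter_upwards [exists_nat_combination_mem (α := β) (β := α) hα0 (p := v) (q := w)
        (ε := Real.log ρ) (by linarith) (by linarith)] with Y hY
      obtain ⟨i, j, h⟩ := hY
      exact ⟨j, i, by linarith, by linarith⟩
  have hev : ∀ k₀ ∈ Finset.range K, ∀ᶠ X : ℝ in atTop, ∀ l₀ ∈ Finset.range K, ∃ i j : ℕ,
      X ≤ ((2 ^ (k₀ + K * i) * s ^ (l₀ + K * j) : ℕ) : ℝ) ^ 3 ∧
      ((2 ^ (k₀ + K * i) * s ^ (l₀ + K * j) : ℕ) : ℝ) ^ 3 ≤ ρ * X := by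
    intro k₀ _
    rw [Filter.eventually_all_finset]
    intro l₀ _
    have hY : Tendsto (fun X : ℝ => Real.log X + -(3 * k₀ * Real.log 2 + 3 * l₀ * Real.log s))
        atTop atTop := tendsto_atTop_add_const_right _ _ Real.tendsto_log_atTop
    filter_upwards [hY.eventually hcomb, eventually_gt_atTop 0] with X hX hX0
    obtain ⟨i, j, h1, h2⟩ := hX
    have hlog : Real.log (((2 ^ (k₀ + K * i) * s ^ (l₀ + K * j) : ℕ) : ℝ) ^ 3) =
        i * α + j * β + (3 * k₀ * Real.log 2 + 3 * l₀ * Real.log s) := by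
      push_cast
      rw [Real.log_pow, Real.log_mul (by positivity) (by positivity), Real.log_pow, Real.log_pow]
      push_cast
      ring
    have hpos : (0 : ℝ) < ((2 ^ (k₀ + K * i) * s ^ (l₀ + K * j) : ℕ) : ℝ) ^ 3 := by
      have : 0 < s := by omega
      positivity
    refine ⟨i, j, ?_, ?_⟩
    · rw [← Real.log_le_log_iff hX0 hpos, hlog]; linarith
    · rw [← Real.log_le_log_iff hpos (by positivity), hlog,
        Real.log_mul (by positivity) (by positivity)]
      linarith
  rw [← Filter.eventually_all_finset] at hev
  filter_upwards [hev] with X hX k₀ hk₀ l₀ hl₀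
  exact hX k₀ (Finset.mem_range.mpr hk₀) l₀ (Finset.mem_range.mpr hl₀)

theorem pow_add_totient_mul_modEq {a D : ℕ} (h : a.Coprime D) (k i : ℕ) :
    a ^ (k % D.totient + D.totient * i) ≡ a ^ k [MOD D] := by
  have key : ∀ j, a ^ (k % D.totient + D.totient * j) ≡ a ^ (k % D.totient) [MOD D] := by
    intro j
    have h1 := (Nat.ModEq.pow_totient h).pow j
    rw [one_pow, ← pow_mul] at h1
    simpa [pow_add] using h1.mul_left (a ^ (k % D.totient))
  refine (key i).trans ?_
  conv_rhs => rw [← Nat.mod_add_div k D.totient]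
  exact (key _).symm

theorem isSumSevenTet_of_bounds {N m t μ g w r β₁ β₂ β₃ c₁ c₂ c₃ e₁ e₂ e₃ : ℕ}
    (hform : RepresentsClass e₁ e₂ e₃ w r) (hrw : r < w) (hμ : 0 < μ) (hm : 0 < m)
    (hβ₁ : 0 < β₁) (hβ₂ : 0 < β₂) (hβ₃ : 0 < β₃)
    (h₁ : β₁ * c₁ ^ 2 = e₁ * μ) (h₂ : β₂ * c₂ ^ 2 = e₂ * μ) (h₃ : β₃ * c₃ ^ 2 = e₃ * μ)
    (hg₁ : g ^ 3 < 6 * β₁ ^ 3) (hg₂ : g ^ 3 < 6 * β₂ ^ 3) (hg₃ : g ^ 3 < 6 * β₃ ^ 3)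
    (hlow : (2 * (β₁ ^ 3 + β₂ ^ 3 + β₃ ^ 3) + g ^ 3) * m ^ 3 ≤ 6 * N)
    (hupp : 6 * N + m * (2 * (β₁ + β₂ + β₃) + g) ≤
      (2 * (β₁ ^ 3 + β₂ ^ 3 + β₃ ^ 3) + g ^ 3 + 1) * m ^ 3)
    (ht : t < g * m)
    (hdvd : (w * μ * m : ℤ) ∣ N - 2 * (tet (m * β₁) + tet (m * β₂) + tet (m * β₃)) -
      r * μ * m - tet t) : IsSumSevenTet N := by
  obtain ⟨z, hz⟩ := hdvd
  have ht3 : (t : ℤ) ^ 3 ≤ (g * m) ^ 3 := by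
    have : (t : ℤ) ≤ g * m := by exact_mod_cast ht.le
    gcongr
  have ht1 : (t : ℤ) ≤ g * m := by exact_mod_cast ht.le
  have hM : (0 : ℤ) < μ * m := by positivity
  have e1 := six_mul_tet (m * β₁)
  have e2 := six_mul_tet (m * β₂)
  have e3 := six_mul_tet (m * β₃)
  have e4 := six_mul_tet t
  zify at hlow hupp
  have hlow' : (2 * (β₁ ^ 3 + β₂ ^ 3 + β₃ ^ 3)) * m ^ 3 + (g * m) ^ 3 ≤ 6 * (N : ℤ) := by
    refine le_trans (le_of_eq ?_) hlow
    ring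
  have hMR : 6 * (μ * m * (r + w * z) : ℤ) = 6 * N - (t ^ 3 - t) -
      2 * (β₁ ^ 3 + β₂ ^ 3 + β₃ ^ 3) * m ^ 3 + 2 * m * (β₁ + β₂ + β₃) := by
    linear_combination -6 * hz - e4 - 2 * e1 - 2 * e2 - 2 * e3
  have hnn : (0 : ℤ) ≤ 2 * m * (β₁ + β₂ + β₃) := by positivity
  have ht0 : (0 : ℤ) ≤ t := by positivity
  have ht30 : (0 : ℤ) ≤ t ^ 3 := by positivity
  have hR0 : (0 : ℤ) ≤ r + w * z := by
    have : (0 : ℤ) ≤ μ * m * (r + w * z) := by linarith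
    exact nonneg_of_mul_nonneg_right this hM
  have hup : 6 * (μ * m * (r + w * z) : ℤ) ≤ (g ^ 3 + 1) * m ^ 3 := by
    rw [hMR]
    linarith
  obtain ⟨R, hR⟩ := Int.eq_ofNat_of_zero_le hR0
  rw [hR] at hup
  have bound : ∀ β : ℕ, g ^ 3 < 6 * β ^ 3 → (μ * m : ℤ) * R ≤ (m * β) ^ 3 := by
    intro β h
    zify at h
    have : ((g : ℤ) ^ 3 + 1) * m ^ 3 ≤ 6 * β ^ 3 * m ^ 3 := by
      gcongr
      linarith
    rw [mul_pow]
    linarith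
  have hRw : R % w = r := by
    zify
    rw [← hR, Int.add_mul_emod_self_left]
    exact Int.emod_eq_of_lt (by positivity) (by exact_mod_cast hrw)
  zify at h₁ h₂ h₃
  refine isSumSevenTet_of_eq (M := μ * m) (t := t) (b₁ := m * β₁) (b₂ := m * β₂) (b₃ := m * β₃)
    (c₁ := c₁) (c₂ := c₂) (c₃ := c₃) hform hRw (by positivity) (by positivity) (by positivity)
    (by positivity) hM.le ?_ ?_ ?_ (bound _ hg₁) (bound _ hg₂) (bound _ hg₃) ?_
  · linear_combination m * h₁
  · linear_combination m * h₂
  · linear_combination m * h₃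
  · rw [← hR]; linear_combination hz

theorem eventually_isSumSevenTet {s D μ g w r β₁ β₂ β₃ c₁ c₂ c₃ e₁ e₂ e₃ : ℕ}
    (hs : Odd s) (hs1 : 1 < s) (hD : (2 * s).Coprime D) (hD0 : 0 < D)
    (hform : RepresentsClass e₁ e₂ e₃ w r) (hrw : r < w) (hμ : 0 < μ)
    (hβ₁ : 0 < β₁) (hβ₂ : 0 < β₂) (hβ₃ : 0 < β₃)
    (h₁ : β₁ * c₁ ^ 2 = e₁ * μ) (h₂ : β₂ * c₂ ^ 2 = e₂ * μ) (h₃ : β₃ * c₃ ^ 2 = e₃ * μ)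
    (hg₁ : g ^ 3 < 6 * β₁ ^ 3) (hg₂ : g ^ 3 < 6 * β₂ ^ 3) (hg₃ : g ^ 3 < 6 * β₃ ^ 3) :
    ∀ᶠ N : ℕ in atTop, ∀ k₀ l₀ : ℕ, (∀ k l m : ℕ, m = 2 ^ k * s ^ l →
      m ≡ 2 ^ k₀ * s ^ l₀ [MOD D] → ∃ t : ℕ, t < g * m ∧
      (w * μ * m : ℤ) ∣ N - 2 * (tet (m * β₁) + tet (m * β₂) + tet (m * β₃)) -
        r * μ * m - tet t) → IsSumSevenTet N := by
  have h2D : Nat.Coprime 2 D := Nat.Coprime.coprime_mul_right hD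
  have hsD : Nat.Coprime s D := Nat.Coprime.coprime_mul_left hD
  have hK : 0 < D.totient := Nat.totient_pos.mpr hD0
  set B := 2 * (β₁ ^ 3 + β₂ ^ 3 + β₃ ^ 3) + g ^ 3 with hB
  set c := 2 * (β₁ + β₂ + β₃) + g with hc
  have hB0 : 0 < B := by positivity
  have hB0' : (0 : ℝ) < B := by exact_mod_cast hB0
  have hρ : 1 < (B + 1 / 2 : ℝ) / B := by
    rw [one_lt_div hB0']; linarith
  have hX : Tendsto (fun N : ℕ => (6 * N : ℝ) / (B + 1 / 2)) atTop atTop :=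
    (tendsto_natCast_atTop_atTop.const_mul_atTop (by norm_num)).atTop_div_const (by positivity)
  filter_upwards [hX.eventually (eventually_exists_pow_mul_pow_mem hs hs1 hK hρ),
    hX.eventually (eventually_ge_atTop ((2 * c + 1 : ℝ) ^ 3))] with N hN hNc k₀ l₀ H
  obtain ⟨i, j, hlo, hup⟩ := hN _ (Nat.mod_lt k₀ hK) _ (Nat.mod_lt l₀ hK)
  generalize hm : 2 ^ (k₀ % D.totient + D.totient * i) * s ^ (l₀ % D.totient + D.totient * j) = m
    at hlo hup
  have hm0 : 0 < m := by rw [← hm]; positivity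
  obtain ⟨t, ht, hdvd⟩ := H _ _ m hm.symm (by
    rw [← hm]
    exact (pow_add_totient_mul_modEq h2D _ _).mul (pow_add_totient_mul_modEq hsD _ _))
  have hmc : 2 * c + 1 ≤ m := by
    have : (2 * c + 1 : ℝ) ^ 3 ≤ (m : ℝ) ^ 3 := hNc.trans hlo
    have := le_of_pow_le_pow_left₀ (by norm_num) (by positivity) this
    exact_mod_cast this
  refine isSumSevenTet_of_bounds hform hrw hμ hm0 hβ₁ hβ₂ hβ₃ h₁ h₂ h₃ hg₁ hg₂ hg₃ ?_ ?_ ht hdvd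
  · have : (B : ℝ) * m ^ 3 ≤ 6 * N := by
      calc (B : ℝ) * m ^ 3 ≤ B * ((B + 1 / 2) / B * (6 * N / (B + 1 / 2))) := by gcongr
        _ = 6 * N := by field_simp
    exact_mod_cast this
  · rw [div_le_iff₀ (by positivity)] at hlo
    have h1 : 2 * (6 * N) ≤ (2 * B + 1) * m ^ 3 := by
      have : (2 : ℝ) * (6 * N) ≤ (2 * B + 1) * m ^ 3 := by linarith
      exact_mod_cast this
    have h2 : 2 * (m * c) ≤ m ^ 3 := by
      calc 2 * (m * c) = m * (2 * c) := by ring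
        _ ≤ m * (m * m) := Nat.mul_le_mul_left _ (by nlinarith)
        _ = m ^ 3 := by ring
    rw [← hB, ← hc]
    linarith

theorem dvd_tet {F x : ℤ} (hF : IsCoprime F 6) (h : F ∣ x) : F ∣ tet x := by
  refine hF.dvd_of_dvd_mul_left ?_
  rw [six_mul_tet]
  exact dvd_sub (dvd_pow h (by norm_num)) h

theorem dvd_tet_sub_tet {F x y : ℤ} (hF : IsCoprime F 6) (h : F ∣ x - y) :
    F ∣ tet x - tet y := by
  refine hF.dvd_of_dvd_mul_left ?_
  have : 6 * (tet x - tet y) = (x - y) * (x ^ 2 + x * y + y ^ 2 - 1) := by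
    linear_combination six_mul_tet x - six_mul_tet y
  rw [this]
  exact h.mul_right _

/-- On some residue class modulo `H`, the polynomial `tet` is congruent to `X` modulo `F`. -/
def TetSol (F H X : ℤ) : Prop := ∃ t₀ : ℤ, ∀ t, H ∣ t - t₀ → F ∣ X - tet t

theorem TetSol.mul {F₁ F₂ H₁ H₂ X : ℤ} (h₁ : TetSol F₁ H₁ X) (h₂ : TetSol F₂ H₂ X)
    (hF : IsCoprime F₁ F₂) (hH : IsCoprime H₁ H₂) : TetSol (F₁ * F₂) (H₁ * H₂) X := by
  obtain ⟨t₁, h₁⟩ := h₁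
  obtain ⟨t₂, h₂⟩ := h₂
  obtain ⟨u, v, huv⟩ := hH
  refine ⟨t₁ * (v * H₂) + t₂ * (u * H₁), fun t ht => hF.mul_dvd (h₁ t ?_) (h₂ t ?_)⟩
  · obtain ⟨z, hz⟩ := ht
    exact ⟨H₂ * z + (t₂ - t₁) * u, by linear_combination hz + t₁ * huv⟩
  · obtain ⟨z, hz⟩ := ht
    exact ⟨H₁ * z + (t₁ - t₂) * v, by linear_combination hz + t₂ * huv⟩

theorem TetSol.exists_nat {F H X : ℤ} (h : TetSol F H X) (hH : 0 < H) :
    ∃ t : ℕ, t < H ∧ F ∣ X - tet t := by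
  obtain ⟨t₀, h⟩ := h
  refine ⟨(t₀ % H).toNat, ?_, h _ ?_⟩ <;> rw [Int.toNat_of_nonneg (Int.emod_nonneg _ hH.ne')]
  · exact Int.emod_lt_of_pos _ hH
  · exact ⟨-(t₀ / H), by linear_combination Int.emod_add_mul_ediv t₀ H⟩

theorem TetSol.exists_nat_of_steering {F H X h₀ : ℤ} {n γ : ℕ} (h : TetSol F H X) (hH : 0 < H)
    (hn : IsCoprime F n) (hn6 : IsCoprime (n : ℤ) 6) (hX : (n : ℤ) ∣ X) (hh₀ : (n : ℤ) ∣ H - h₀)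
    (hγ : ∀ c : ZMod n, ∃ σ < γ, (c + h₀ * (σ : ℕ)) ^ 3 = c + h₀ * σ) :
    ∃ t : ℕ, t < γ * H ∧ F * n ∣ X - tet t := by
  obtain ⟨t₀, h⟩ := h
  obtain ⟨σ, hσ, hc⟩ := hγ ((t₀ % H : ℤ) : ZMod n)
  have hpos : 0 ≤ t₀ % H := Int.emod_nonneg _ hH.ne'
  have hlt : t₀ % H < H := Int.emod_lt_of_pos _ hH
  have hσ' : (σ : ℤ) + 1 ≤ γ := by exact_mod_cast hσ
  have hT : 0 ≤ t₀ % H + H * σ := by positivity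
  refine ⟨(t₀ % H + H * σ).toNat, ?_, hn.mul_dvd (h _ ?_) ?_⟩ <;> rw [Int.toNat_of_nonneg hT]
  · nlinarith
  · exact ⟨σ - t₀ / H, by linear_combination Int.emod_add_mul_ediv t₀ H⟩
  · refine dvd_sub hX (hn6.dvd_of_dvd_mul_left ?_)
    rw [six_mul_tet, ← ZMod.intCast_zmod_eq_zero_iff_dvd]
    have hH0 : (H : ZMod n) = h₀ := by
      rwa [← sub_eq_zero, ← Int.cast_sub, ZMod.intCast_zmod_eq_zero_iff_dvd]
    push_cast at hc ⊢
    rw [hH0, hc, sub_self]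

theorem exists_pow_dvd_six_mul_sub {p : ℕ} (hp : p.Prime) {X r : ℤ}
    (hr : (p : ℤ) ∣ 6 * X - (r ^ 3 - r)) (hr' : ¬ (p : ℤ) ∣ 3 * r ^ 2 - 1) (n : ℕ) :
    ∃ t : ℤ, (p : ℤ) ∣ t - r ∧ (p : ℤ) ^ (n + 1) ∣ 6 * X - (t ^ 3 - t) := by
  induction n with
  | zero => exact ⟨r, by simp, by simpa using hr⟩
  | succ n ih =>
    obtain ⟨t, ⟨b, hb⟩, a, ha⟩ := ih
    have ht : ¬ (p : ℤ) ∣ 3 * t ^ 2 - 1 := fun h => hr' (by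
      have : 3 * r ^ 2 - 1 = (3 * t ^ 2 - 1) - p * (b * (3 * (t + r))) := by
        linear_combination -3 * (t + r) * hb
      rw [this]
      exact dvd_sub h (dvd_mul_right _ _))
    obtain ⟨u, v, huv⟩ := (Nat.prime_iff_prime_int.mp hp).irreducible.coprime_iff_not_dvd.mpr ht
    refine ⟨t + p ^ (n + 1) * (v * a), ⟨b + p ^ n * (v * a), ?_⟩, ?_⟩
    · linear_combination hb
    · refine ⟨a * u - (v * a) ^ 2 * p ^ n * (3 * t + p ^ (n + 1) * (v * a)), ?_⟩
      linear_combination ha - p ^ (n + 1) * a * huv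

/-- The equation `tet t = X` has a simple root modulo `p`. -/
def HasSimpleRoot (p : ℕ) (X : ℤ) : Prop :=
  ∃ r : ℤ, (p : ℤ) ∣ 6 * X - (r ^ 3 - r) ∧ ¬ (p : ℤ) ∣ 3 * r ^ 2 - 1

theorem dvd_six_mul_sub_of_dvd {F X t t₀ : ℤ} (h : F ∣ 6 * X - (t₀ ^ 3 - t₀)) (ht : F ∣ t - t₀) :
    F ∣ 6 * (X - tet t) := by
  have : 6 * (X - tet t) =
      (6 * X - (t₀ ^ 3 - t₀)) - (t - t₀) * (t ^ 2 + t * t₀ + t₀ ^ 2 - 1) := by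
    linear_combination -six_mul_tet t
  rw [this]
  exact dvd_sub h (ht.mul_right _)

theorem HasSimpleRoot.tetSol {p : ℕ} {X : ℤ} (h : HasSimpleRoot p X) (hp : p.Prime)
    (h6 : IsCoprime (p : ℤ) 6) (n : ℕ) : TetSol (p ^ n) (p ^ n) X := by
  obtain ⟨r, hr, hr'⟩ := h
  obtain ⟨t₀, -, ht₀⟩ := exists_pow_dvd_six_mul_sub hp hr hr' n
  refine ⟨t₀, fun t ht => h6.pow_left.dvd_of_dvd_mul_left
    (dvd_six_mul_sub_of_dvd ((pow_dvd_pow _ n.le_succ).trans ht₀) ht)⟩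

theorem HasSimpleRoot.congr {p : ℕ} {X Y : ℤ} (h : HasSimpleRoot p X) (hXY : (p : ℤ) ∣ X - Y) :
    HasSimpleRoot p Y := by
  obtain ⟨r, hr, hr'⟩ := h
  refine ⟨r, ?_, hr'⟩
  have h := dvd_sub hr (hXY.mul_left 6)
  rwa [show 6 * X - (r ^ 3 - r) - 6 * (X - Y) = 6 * Y - (r ^ 3 - r) by ring] at h

theorem tetSol_two_pow (n : ℕ) (X : ℤ) : TetSol (2 ^ n) (2 ^ (n + 1)) X := by
  obtain ⟨t₀, -, ht₀⟩ := exists_pow_dvd_six_mul_sub (r := 0) (X := X) Nat.prime_two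
    ⟨3 * X, by push_cast; ring⟩ (by norm_num) n
  refine ⟨t₀, fun t ht => ?_⟩
  obtain ⟨a, ha⟩ := dvd_six_mul_sub_of_dvd ht₀ (by exact_mod_cast ht)
  have hco : IsCoprime ((2 : ℤ) ^ n) 3 := (by norm_num : IsCoprime (2 : ℤ) 3).pow_left
  refine hco.dvd_of_dvd_mul_left ⟨a, ?_⟩
  push_cast at ha
  rw [pow_succ] at ha
  linarith

theorem tetSol_three_pow (n : ℕ) (X : ℤ) : TetSol (3 ^ n) (3 ^ (n + 1)) X := by
  obtain ⟨t₀, -, ht₀⟩ := exists_pow_dvd_six_mul_sub (r := 0) (X := X) Nat.prime_three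
    ⟨2 * X, by push_cast; ring⟩ (by norm_num) n
  refine ⟨t₀, fun t ht => ?_⟩
  obtain ⟨a, ha⟩ := dvd_six_mul_sub_of_dvd ht₀ (by exact_mod_cast ht)
  have hco : IsCoprime ((3 : ℤ) ^ n) 2 := (by norm_num : IsCoprime (3 : ℤ) 2).pow_left
  refine hco.dvd_of_dvd_mul_left ⟨a, ?_⟩
  push_cast at ha
  rw [pow_succ] at ha
  linarith

theorem tetSol_sq_of_critical {Q X c : ℤ} (h6 : IsCoprime Q 6) (hc : Q ∣ 3 * c ^ 2 - 1)
    (hX : Q ^ 2 ∣ X - tet c) : TetSol (Q ^ 2) Q X := by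
  refine ⟨c, fun t ⟨z, hz⟩ => ?_⟩
  obtain ⟨a, ha⟩ := hc
  have h : Q ^ 2 ∣ tet t - tet c := by
    refine h6.pow_left.dvd_of_dvd_mul_left ⟨z * a + 3 * c * z ^ 2 + Q * z ^ 3, ?_⟩
    obtain rfl : t = c + Q * z := by linarith
    linear_combination six_mul_tet (c + Q * z) - six_mul_tet c + Q * z * ha
  have := dvd_sub hX h
  rwa [sub_sub_sub_cancel_right] at this

theorem exists_pow_dvd_three_mul_sq_sub_one {q : ℕ} (hq : q.Prime) (hq6 : IsCoprime (q : ℤ) 6)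
    {c₀ : ℤ} (hc : (q : ℤ) ∣ 3 * c₀ ^ 2 - 1) (n : ℕ) :
    ∃ c : ℤ, (q : ℤ) ∣ c - c₀ ∧ (q : ℤ) ^ (n + 1) ∣ 3 * c ^ 2 - 1 := by
  have hq' := Nat.prime_iff_prime_int.mp hq
  induction n with
  | zero => exact ⟨c₀, by simp, by simpa using hc⟩
  | succ n ih =>
    obtain ⟨c, hcc, a, ha⟩ := ih
    have hnc : ¬ (q : ℤ) ∣ 6 * c := by
      intro h
      have h1 : (q : ℤ) ∣ c := hq6.dvd_of_dvd_mul_left h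
      have h2 : (q : ℤ) ∣ 3 * c ^ 2 - 1 := by rw [ha, pow_succ]; exact ⟨q ^ n * a, by ring⟩
      have h3 : (q : ℤ) ∣ 1 := by
        have := dvd_sub ((h1.mul_right c).mul_left 3) h2
        rwa [show 3 * (c * c) - (3 * c ^ 2 - 1) = 1 by ring] at this
      exact hq'.not_isUnit (isUnit_of_dvd_one h3)
    obtain ⟨u, v, huv⟩ := hq'.irreducible.coprime_iff_not_dvd.mpr hnc
    refine ⟨c - q ^ (n + 1) * (v * a), ?_, ?_⟩
    · rw [sub_right_comm]
      exact dvd_sub hcc ⟨q ^ n * (v * a), by ring⟩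
    · refine ⟨a * u + 3 * q ^ n * (v * a) ^ 2, ?_⟩
      linear_combination ha - q ^ (n + 1) * a * huv

theorem exists_pow_dvd_sub_two_mul_tet {q : ℕ} (hq : q.Prime) (hq6 : IsCoprime (q : ℤ) 6)
    {X y₀ : ℤ} (hy : ¬ (q : ℤ) ∣ 3 * y₀ ^ 2 - 1) (hX : (q : ℤ) ∣ 6 * X - 2 * (y₀ ^ 3 - y₀))
    (n : ℕ) : ∃ y : ℤ, (q : ℤ) ∣ y - y₀ ∧ (q : ℤ) ^ (n + 1) ∣ X - 2 * tet y := by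
  have h2 : IsCoprime (q : ℤ) 2 := IsCoprime.of_mul_right_left (z := 3) (by norm_num; exact hq6)
  obtain ⟨u, v, huv⟩ := (h2.pow_left (m := n + 1))
  have hX' : (q : ℤ) ∣ 6 * (v * X) - (y₀ ^ 3 - y₀) := by
    refine h2.dvd_of_dvd_mul_left ?_
    have := dvd_sub hX ⟨q ^ n * (u * X * 6), rfl⟩
    rwa [show 6 * X - 2 * (y₀ ^ 3 - y₀) - q * (q ^ n * (u * X * 6)) =
      2 * (6 * (v * X) - (y₀ ^ 3 - y₀)) by linear_combination -6 * X * huv] at this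
  obtain ⟨y, hy0, a, ha⟩ := exists_pow_dvd_six_mul_sub hq hX' hy n
  refine ⟨y, hy0, hq6.pow_left.dvd_of_dvd_mul_left ⟨6 * u * X + 2 * a, ?_⟩⟩
  linear_combination 2 * ha - 6 * X * huv - 2 * six_mul_tet y

/-- `N` is congruent modulo `q` to `tet c + 2 tet y` where `c` is a critical point of `tet` and
`y` is a noncritical unit. -/
structure IsGoodPair (q : ℕ) (N c y : ℤ) : Prop where
  critical : (q : ℤ) ∣ 3 * c ^ 2 - 1
  not_dvd : ¬ (q : ℤ) ∣ y
  noncritical : ¬ (q : ℤ) ∣ 3 * y ^ 2 - 1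
  dvd : (q : ℤ) ∣ 6 * N - (c ^ 3 - c) - 2 * (y ^ 3 - y)

theorem IsGoodPair.lift {q : ℕ} {N c₀ y₀ : ℤ} (h : IsGoodPair q N c₀ y₀) (hq : q.Prime)
    (hq6 : IsCoprime (q : ℤ) 6) (n : ℕ) : ∃ c y : ℤ, (q : ℤ) ∣ y - y₀ ∧
      (q : ℤ) ^ (n + 1) ∣ 3 * c ^ 2 - 1 ∧ ((q : ℤ) ^ (n + 1)) ^ 2 ∣ N - tet c - 2 * tet y := by
  obtain ⟨c, hc0, hc⟩ := exists_pow_dvd_three_mul_sq_sub_one hq hq6 h.critical n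
  have hX : (q : ℤ) ∣ 6 * (N - tet c) - 2 * (y₀ ^ 3 - y₀) := by
    have := dvd_sub h.dvd (hc0.mul_right (c ^ 2 + c * c₀ + c₀ ^ 2 - 1))
    rwa [show 6 * N - (c₀ ^ 3 - c₀) - 2 * (y₀ ^ 3 - y₀) - (c - c₀) * (c ^ 2 + c * c₀ + c₀ ^ 2 - 1)
      = 6 * (N - tet c) - 2 * (y₀ ^ 3 - y₀) by linear_combination six_mul_tet c] at this
  obtain ⟨y, hy0, hy⟩ := exists_pow_dvd_sub_two_mul_tet hq hq6 h.noncritical hX (2 * n + 1)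
  refine ⟨c, y, hy0, hc, ?_⟩
  rw [← pow_mul]
  convert hy using 2
  ring

/-- The odd prime `q` divides `2 ^ 180 - 1` exactly once. -/
structure IsLiftPrime (q : ℕ) : Prop where
  prime : q.Prime
  coprime_six : IsCoprime (q : ℤ) 6
  dvd : (q : ℤ) ∣ 2 ^ 180 - 1
  not_dvd : ¬ (q : ℤ) ^ 2 ∣ 2 ^ 180 - 1

theorem IsLiftPrime.exists_pow_eq {q : ℕ} (h : IsLiftPrime q) (n : ℕ) :
    ∃ w : ℤ, ((2 : ℤ) ^ 180) ^ q ^ n = 1 + q ^ (n + 1) * w ∧ ¬ (q : ℤ) ∣ w := by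
  have hq' := Nat.prime_iff_prime_int.mp h.prime
  have hodd : Odd q := by
    refine h.prime.odd_of_ne_two ?_
    rintro rfl
    exact absurd h.coprime_six (by norm_num)
  have hu : ¬ (q : ℤ) ∣ 2 ^ 180 := fun h2 => hq'.not_isUnit (isUnit_of_dvd_one (by
    have := dvd_sub h2 h.dvd
    rwa [sub_sub_cancel] at this))
  have hm := Int.emultiplicity_pow_sub_pow h.prime hodd (x := 2 ^ 180) (y := 1) h.dvd hu (q ^ n)
  have h1 : emultiplicity (q : ℤ) (2 ^ 180 - 1) = 1 := by
    have := emultiplicity_eq_of_dvd_of_not_dvd (k := 1) (by simpa using h.dvd) h.not_dvd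
    simpa using this
  have h2 : emultiplicity q (q ^ n) = n := emultiplicity_pow_self_of_prime h.prime.prime n
  rw [h1, h2, one_pow] at hm
  have hm' : emultiplicity (q : ℤ) ((2 ^ 180) ^ q ^ n - 1) = (n + 1 : ℕ) := by
    rw [hm]; push_cast; ring
  obtain ⟨hd, hnd⟩ := emultiplicity_eq_coe.mp hm'
  obtain ⟨w, hw⟩ := hd
  refine ⟨w, by rw [← hw]; ring, fun ⟨v, hv⟩ => hnd ⟨v, ?_⟩⟩
  rw [hw, hv]; ring

theorem IsLiftPrime.exists_forall_modEq {q : ℕ} (h : IsLiftPrime q) {a b : ℤ}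
    (hab : (q : ℤ) ∣ a - b) (ha : ¬ (q : ℤ) ∣ a) (n : ℕ) :
    ∃ i₀ : ℕ, ∀ i, i ≡ i₀ [MOD q ^ n] → (q : ℤ) ^ (n + 1) ∣ (2 ^ 180) ^ i * a - b := by
  have hq' := Nat.prime_iff_prime_int.mp h.prime
  suffices ∃ i₀ : ℕ, (q : ℤ) ^ (n + 1) ∣ (2 ^ 180) ^ i₀ * a - b by
    obtain ⟨i₀, hi₀⟩ := this
    refine ⟨i₀, fun i hi => ?_⟩
    obtain ⟨w, hw, -⟩ := h.exists_pow_eq n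
    have hu : ∀ j : ℕ, ((2 : ℤ) ^ 180) ^ j ≡ (2 ^ 180) ^ (j % q ^ n) [ZMOD q ^ (n + 1)] := by
      intro j
      conv_lhs => rw [← Nat.mod_add_div j (q ^ n), pow_add, pow_mul _ (q ^ n), hw]
      have h1 : (1 + q ^ (n + 1) * w : ℤ) ≡ 1 [ZMOD q ^ (n + 1)] :=
        (Int.modEq_iff_dvd.mpr ⟨-w, by ring⟩)
      have h2 := (h1.pow (j / q ^ n)).mul_left ((2 ^ 180) ^ (j % q ^ n))
      rwa [one_pow, mul_one] at h2
    have h2 : ((2 : ℤ) ^ 180) ^ i * a ≡ b [ZMOD q ^ (n + 1)] := by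
      refine Int.ModEq.trans ?_ (Int.modEq_iff_dvd.mpr hi₀).symm
      refine Int.ModEq.mul_right a ((hu i).trans ?_)
      rw [show i % q ^ n = i₀ % q ^ n from hi]
      exact (hu i₀).symm
    exact Int.modEq_iff_dvd.mp h2.symm
  induction n with
  | zero => exact ⟨0, by simpa using hab⟩
  | succ n ih =>
    obtain ⟨i, z, hz⟩ := ih
    obtain ⟨w, hw, hw'⟩ := h.exists_pow_eq n
    have hu : ¬ (q : ℤ) ∣ (2 ^ 180) ^ i := fun h2 => hq'.not_isUnit (isUnit_of_dvd_one (by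
      have := dvd_sub (hq'.dvd_of_dvd_pow h2) h.dvd
      rwa [sub_sub_cancel] at this))
    have hunit : ¬ (q : ℤ) ∣ (2 ^ 180) ^ i * a * w := by
      rw [hq'.dvd_mul, hq'.dvd_mul]; tauto
    obtain ⟨r, v, hrv⟩ := hq'.irreducible.coprime_iff_not_dvd.mpr hunit
    set j := ((-v * z) % q).toNat with hj
    have hj' : (j : ℤ) = -v * z - q * ((-v * z) / q) := by
      rw [hj, Int.toNat_of_nonneg (Int.emod_nonneg _ hq'.ne_zero), Int.emod_def]
    obtain ⟨k, hk⟩ := Polynomial.powAddExpansion (1 : ℤ) (q ^ (n + 1) * w) j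
    refine ⟨i + q ^ n * j, z * r - (2 ^ 180) ^ i * a * w * ((-v * z) / q) +
      (2 ^ 180) ^ i * a * k * w ^ 2 * q ^ n, ?_⟩
    rw [pow_add, pow_mul _ (q ^ n), hw, hk, one_pow, one_pow, hj']
    generalize ((2 : ℤ) ^ 180) ^ i = U at *
    generalize (-v * z) / (q : ℤ) = d at *
    linear_combination hz - z * q ^ (n + 1) * hrv

theorem exists_two_pow_mul_modEq {q₁ q₂ q₃ : ℕ} (h₁ : IsLiftPrime q₁) (h₂ : IsLiftPrime q₂)
    (h₃ : IsLiftPrime q₃) (h₁₂ : q₁ ≠ q₂) (h₁₃ : q₁ ≠ q₃) (h₂₃ : q₂ ≠ q₃)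
    {a₁ a₂ a₃ b₁ b₂ b₃ : ℤ} {x : ℕ} (hab₁ : (q₁ : ℤ) ∣ 2 ^ x * a₁ - b₁)
    (hab₂ : (q₂ : ℤ) ∣ 2 ^ x * a₂ - b₂) (hab₃ : (q₃ : ℤ) ∣ 2 ^ x * a₃ - b₃)
    (hb₁ : ¬ (q₁ : ℤ) ∣ b₁) (hb₂ : ¬ (q₂ : ℤ) ∣ b₂) (hb₃ : ¬ (q₃ : ℤ) ∣ b₃) (n₁ n₂ n₃ : ℕ) :
    ∃ k : ℕ, (q₁ : ℤ) ^ (n₁ + 1) ∣ 2 ^ k * a₁ - b₁ ∧ (q₂ : ℤ) ^ (n₂ + 1) ∣ 2 ^ k * a₂ - b₂ ∧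
      (q₃ : ℤ) ^ (n₃ + 1) ∣ 2 ^ k * a₃ - b₃ := by
  have unit : ∀ {q : ℕ} {a b : ℤ}, (q : ℤ) ∣ a - b → ¬ (q : ℤ) ∣ b → ¬ (q : ℤ) ∣ a :=
    fun h hb ha => hb ((dvd_sub_right ha).mp h)
  obtain ⟨i₁, hi₁⟩ := h₁.exists_forall_modEq hab₁ (unit hab₁ hb₁) n₁
  obtain ⟨i₂, hi₂⟩ := h₂.exists_forall_modEq hab₂ (unit hab₂ hb₂) n₂
  obtain ⟨i₃, hi₃⟩ := h₃.exists_forall_modEq hab₃ (unit hab₃ hb₃) n₃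
  have c₁₂ := Nat.coprime_pow_primes n₁ n₂ h₁.prime h₂.prime h₁₂
  have c₁₃ := Nat.coprime_pow_primes n₁ n₃ h₁.prime h₃.prime h₁₃
  have c₂₃ := Nat.coprime_pow_primes n₂ n₃ h₂.prime h₃.prime h₂₃
  obtain ⟨j, hj₁, hj₂⟩ := Nat.chineseRemainder c₁₂ i₁ i₂
  obtain ⟨i, hij, hi3⟩ := Nat.chineseRemainder (c₁₃.mul_left c₂₃) j i₃
  have e : ∀ a : ℤ, 2 ^ (180 * i + x) * a = (2 ^ 180) ^ i * (2 ^ x * a) := fun a => by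
    rw [pow_add, pow_mul]; ring
  refine ⟨180 * i + x, ?_, ?_, ?_⟩ <;> rw [e]
  · exact hi₁ _ ((hij.of_mul_right _).trans hj₁)
  · exact hi₂ _ ((hij.of_mul_left _).trans hj₂)
  · exact hi₃ _ hi3

theorem HasSimpleRoot.tetSol_of_dvd_sub {p l : ℕ} {N X : ℤ} (h : HasSimpleRoot p N) (hp : p.Prime)
    (h6 : IsCoprime (p : ℤ) 6) (hX : (p : ℤ) ^ l ∣ N - X) : TetSol (p ^ l) (p ^ l) X := by
  rcases l with _ | l
  · exact ⟨0, fun t _ => by simp⟩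
  · exact (h.congr ((dvd_pow_self _ l.succ_ne_zero).trans hX)).tetSol hp h6 _

/-- The part of `N` left over for the form and the seventh summand when the six paired summands
are centred at `m β₁`, `m β₂`, `m β₃`. -/
def remainder (N : ℤ) (m β₁ β₂ β₃ r μ : ℕ) : ℤ :=
  N - 2 * (tet (m * β₁) + tet (m * β₂) + tet (m * β₃)) - r * μ * m

theorem dvd_sub_remainder {F N : ℤ} {m β₁ β₂ β₃ r μ : ℕ} (h6 : IsCoprime F 6) (h : F ∣ m) :
    F ∣ N - remainder N m β₁ β₂ β₃ r μ := by
  have e : N - remainder N m β₁ β₂ β₃ r μ =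
      2 * (tet (m * β₁) + tet (m * β₂) + tet (m * β₃)) + r * μ * m := by
    rw [remainder]; ring
  have h' : ∀ β : ℕ, F ∣ tet (m * β) := fun β => dvd_tet h6 (h.mul_right _)
  rw [e]
  exact dvd_add (((dvd_add (dvd_add (h' _) (h' _)) (h' _))).mul_left 2) (h.mul_left _)

theorem remainder_swap₁₂ (N : ℤ) (m β₁ β₂ β₃ r μ : ℕ) :
    remainder N m β₁ β₂ β₃ r μ = remainder N m β₂ β₁ β₃ r μ := by
  simp only [remainder]; ring

theorem remainder_swap₁₃ (N : ℤ) (m β₁ β₂ β₃ r μ : ℕ) :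
    remainder N m β₁ β₂ β₃ r μ = remainder N m β₃ β₂ β₁ r μ := by
  simp only [remainder]; ring

theorem dvd_remainder_sub {F N c y : ℤ} {m β₁ β₂ β₃ r μ : ℕ} (h6 : IsCoprime F 6)
    (h₂ : F ∣ β₂) (h₃ : F ∣ β₃) (hμ : F ∣ μ) (hy : F ∣ m * β₁ - y)
    (hN : F ∣ N - c - 2 * tet y) : F ∣ remainder N m β₁ β₂ β₃ r μ - c := by
  have e : remainder N m β₁ β₂ β₃ r μ - c = N - c - 2 * tet y -
      (2 * ((tet (m * β₁) - tet y) + tet (m * β₂) + tet (m * β₃)) + μ * (r * m)) := by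
    rw [remainder]; ring
  rw [e]
  refine dvd_sub hN (dvd_add (Dvd.dvd.mul_left (dvd_add (dvd_add ?_ ?_) ?_) 2) (hμ.mul_right _))
  · exact dvd_tet_sub_tet h6 hy
  · exact dvd_tet h6 (h₂.mul_left _)
  · exact dvd_tet h6 (h₃.mul_left _)

theorem isCoprime_two_of_isCoprime_six {F : ℤ} (h : IsCoprime F 6) : IsCoprime F 2 :=
  IsCoprime.of_mul_right_left (z := 3) (by norm_num; exact h)

theorem odd_of_isCoprime_six {s : ℕ} (h : IsCoprime (s : ℤ) 6) : Odd s := by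
  have := Nat.isCoprime_iff_coprime.mp (show IsCoprime (s : ℤ) (2 : ℕ) from
    isCoprime_two_of_isCoprime_six h)
  exact Nat.coprime_two_right.mp this

theorem isCoprime_of_primes {p q : ℕ} (hp : p.Prime) (hq : q.Prime) (h : p ≠ q) :
    IsCoprime (p : ℤ) q :=
  Nat.isCoprime_iff_coprime.mpr ((Nat.coprime_primes hp hq).mpr h)

theorem eventually_isSumSevenTet_of_dvd {p s γ k₀ : ℕ} (hp : p.Prime) (hp6 : IsCoprime (p : ℤ) 6)
    (hs : s.Prime) (hs6 : IsCoprime (s : ℤ) 6) (hps : p ≠ s) (hsize : (4 * γ) ^ 3 < 6 * p ^ 3)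
    (hγ : ∀ c : ZMod p, ∃ σ < γ, (c + (4 * 2 ^ k₀ : ℤ) * (σ : ℕ)) ^ 3 =
      c + (4 * 2 ^ k₀ : ℤ) * σ) :
    ∀ᶠ N : ℕ in atTop, (p : ℤ) ∣ N → HasSimpleRoot s N → IsSumSevenTet N := by
  have hp0 := hp.pos
  have h2p : IsCoprime (2 : ℤ) p := (isCoprime_two_of_isCoprime_six hp6).symm
  have h2s : IsCoprime (2 : ℤ) s := (isCoprime_two_of_isCoprime_six hs6).symm
  have hsp : IsCoprime (s : ℤ) p := isCoprime_of_primes hs hp hps.symm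
  have hcop : (2 * s).Coprime p := by
    refine Nat.Coprime.mul_left ?_ (Nat.isCoprime_iff_coprime.mp hsp)
    exact Nat.isCoprime_iff_coprime.mp h2p
  filter_upwards [eventually_isSumSevenTet (μ := p) (g := 4 * γ) (β₁ := p) (β₂ := p)
    (β₃ := 2 * p) (c₁ := 1) (c₂ := 1) (c₃ := 1) (odd_of_isCoprime_six hs6) hs.one_lt hcop hp0
    representsClass_one_one_two (by norm_num) hp0 hp0 hp0 (by positivity) (by ring) (by ring)
    (by ring) hsize hsize (by have := pow_pos hp0 3; rw [mul_pow 2]; linarith)] with N hN hpN hroot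
  refine hN k₀ 0 fun k l m hm hmod => ?_
  set X := remainder N m p p (2 * p) 1 p with hX
  have hm0 : 0 < m := by have := hs.pos; rw [hm]; positivity
  have hsm : (s : ℤ) ^ l ∣ m := ⟨2 ^ k, by rw [hm]; push_cast; ring⟩
  have hpX : (p : ℤ) ∣ X := by
    have := dvd_remainder_sub (N := N) (c := 0) (y := 0) (m := m) (β₁ := p) (r := 1) hp6
      (dvd_refl _) (Dvd.intro_left (2 : ℤ) (by push_cast; rfl) : (p : ℤ) ∣ (2 * p : ℕ))
      (dvd_refl _) (by simp) (by simpa [tet] using hpN)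
    simpa using this
  have hsol := (tetSol_two_pow (k + 1) X).mul
    (hroot.tetSol_of_dvd_sub hs hs6 (dvd_sub_remainder hs6.pow_left hsm)) h2s.pow h2s.pow
  have hH : (2 ^ (k + 1 + 1) * s ^ l : ℤ) = 4 * m := by rw [hm]; push_cast; ring
  rw [hH] at hsol
  obtain ⟨t, ht, hdvd⟩ := hsol.exists_nat_of_steering (h₀ := 4 * 2 ^ k₀) (n := p) (by positivity)
    (h2p.pow_left.mul_left hsp.pow_left) hp6 hpX (by
      have := (Int.natCast_modEq_iff.mpr hmod).symm.dvd
      push_cast at this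
      rw [← mul_sub]
      simpa using this.mul_left 4) (by exact_mod_cast hγ)
  refine ⟨t, by zify; linarith, ?_⟩
  convert hdvd using 1
  · rw [hm]; push_cast; ring
  · rw [hX, remainder]

theorem eventually_of_eleven_dvd {s : ℕ} (hs : s.Prime) (hs6 : IsCoprime (s : ℤ) 6)
    (h : 11 ≠ s) : ∀ᶠ N : ℕ in atTop, (11 : ℤ) ∣ N → HasSimpleRoot s N → IsSumSevenTet N :=
  eventually_isSumSevenTet_of_dvd (p := 11) (γ := 4) (k₀ := 6) (by norm_num) (by norm_num) hs hs6 h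
    (by norm_num) (by decide)

theorem eventually_of_thirteen_dvd {s : ℕ} (hs : s.Prime) (hs6 : IsCoprime (s : ℤ) 6)
    (h : 13 ≠ s) : ∀ᶠ N : ℕ in atTop, (13 : ℤ) ∣ N → HasSimpleRoot s N → IsSumSevenTet N :=
  eventually_isSumSevenTet_of_dvd (p := 13) (γ := 5) (k₀ := 8) (by norm_num) (by norm_num) hs hs6 h
    (by norm_num) (by decide)

theorem isLiftPrime_seven : IsLiftPrime 7 := by constructor <;> norm_num
theorem isLiftPrime_eleven : IsLiftPrime 11 := by constructor <;> norm_num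
theorem isLiftPrime_thirteen : IsLiftPrime 13 := by constructor <;> norm_num
theorem isLiftPrime_thirty_seven : IsLiftPrime 37 := by constructor <;> norm_num

theorem dvd_mul_sub_of_modEq {F y : ℤ} {m m₀ D β : ℕ} (hm : m ≡ m₀ [MOD D]) (hD : F ∣ D)
    (h : F ∣ m₀ * β - y) : F ∣ m * β - y := by
  have h1 := (hD.trans (Int.natCast_modEq_iff.mpr hm).symm.dvd).mul_right β
  have := dvd_add h1 h
  rwa [show ((m : ℤ) - m₀) * β + (m₀ * β - y) = m * β - y by ring] at this

theorem not_dvd_of_dvd_sub {q y y₀ : ℤ} (h : q ∣ y - y₀) (hy : ¬ q ∣ y₀) : ¬ q ∣ y :=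
  fun h' => hy ((dvd_sub_right h').mp h)

theorem dvd_sub_of_dvd_sub {q a y y₀ : ℤ} (h : q ∣ a - y₀) (hy : q ∣ y - y₀) : q ∣ a - y := by
  have := dvd_sub h hy
  rwa [sub_sub_sub_cancel_right] at this

theorem eventually_isSumSevenTet_of_pair {s q₁ q₂ n₁ n₂ e₂ e₃ Q₁ Q₂ : ℕ} (hs : s.Prime)
    (hs6 : IsCoprime (s : ℤ) 6) (hq₁ : IsLiftPrime q₁) (hq₂ : IsLiftPrime q₂) (hs₁ : s ≠ q₁)
    (hs₂ : s ≠ q₂) (h₁₂ : q₁ ≠ q₂) (h₁₇ : q₁ ≠ 7) (h₂₇ : q₂ ≠ 7)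
    (hform : RepresentsClass 1 e₂ e₃ 2 1) (he₂ : 0 < e₂) (he₃ : 0 < e₃)
    (hQ₁ : q₁ ^ (n₁ + 1) = Q₁) (hQ₂ : q₂ ^ (n₂ + 1) = Q₂)
    (hg₁ : (4 * (Q₁ * Q₂)) ^ 3 < 6 * (Q₁ ^ 2 * Q₂ ^ 2) ^ 3)
    (hg₂ : (4 * (Q₁ * Q₂)) ^ 3 < 6 * (e₂ * Q₂ ^ 2) ^ 3)
    (hg₃ : (4 * (Q₁ * Q₂)) ^ 3 < 6 * (e₃ * Q₁ ^ 2) ^ 3) :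
    ∀ᶠ N : ℕ in atTop, ∀ (l x : ℕ) (c₁ y₁ c₂ y₂ : ℤ), HasSimpleRoot s N →
      IsGoodPair q₁ N c₁ y₁ → IsGoodPair q₂ N c₂ y₂ →
      (q₁ : ℤ) ∣ 2 ^ x * (s ^ l * (e₂ * Q₂ ^ 2 : ℕ)) - y₁ →
      (q₂ : ℤ) ∣ 2 ^ x * (s ^ l * (e₃ * Q₁ ^ 2 : ℕ)) - y₂ → IsSumSevenTet N := by
  have hq₁0 := hq₁.prime.pos
  have hq₂0 := hq₂.prime.pos
  have hQ₁0 : 0 < Q₁ := by rw [← hQ₁]; positivity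
  have hQ₂0 : 0 < Q₂ := by rw [← hQ₂]; positivity
  have hQ₁' : (q₁ : ℤ) ^ (n₁ + 1) = Q₁ := by rw [← hQ₁]; push_cast; rfl
  have hQ₂' : (q₂ : ℤ) ^ (n₂ + 1) = Q₂ := by rw [← hQ₂]; push_cast; rfl
  have h6₁ : IsCoprime (Q₁ : ℤ) 6 := hQ₁' ▸ hq₁.coprime_six.pow_left
  have h6₂ : IsCoprime (Q₂ : ℤ) 6 := hQ₂' ▸ hq₂.coprime_six.pow_left
  have h2Q₁ := (isCoprime_two_of_isCoprime_six h6₁).symm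
  have h2Q₂ := (isCoprime_two_of_isCoprime_six h6₂).symm
  have h2s := (isCoprime_two_of_isCoprime_six hs6).symm
  have hsQ₁ : IsCoprime (s : ℤ) Q₁ := hQ₁' ▸ (isCoprime_of_primes hs hq₁.prime hs₁).pow_right
  have hsQ₂ : IsCoprime (s : ℤ) Q₂ := hQ₂' ▸ (isCoprime_of_primes hs hq₂.prime hs₂).pow_right
  have hQQ : IsCoprime (Q₁ : ℤ) Q₂ := by
    rw [← hQ₁', ← hQ₂']
    exact (isCoprime_of_primes hq₁.prime hq₂.prime h₁₂).pow
  have hcop : (2 * s).Coprime (Q₁ ^ 2 * Q₂ ^ 2) := by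
    refine Nat.isCoprime_iff_coprime.mp ?_
    push_cast
    exact ((h2Q₁.mul_left hsQ₁).pow_right).mul_right ((h2Q₂.mul_left hsQ₂).pow_right)
  filter_upwards [eventually_isSumSevenTet (μ := Q₁ ^ 2 * Q₂ ^ 2) (g := 4 * (Q₁ * Q₂))
    (β₁ := Q₁ ^ 2 * Q₂ ^ 2) (β₂ := e₂ * Q₂ ^ 2) (β₃ := e₃ * Q₁ ^ 2) (c₁ := 1) (c₂ := Q₁)
    (c₃ := Q₂) (odd_of_isCoprime_six hs6) hs.one_lt hcop (by positivity) hform (by norm_num)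
    (by positivity) (by positivity) (by positivity) (by positivity) (by ring) (by ring)
    (by ring) hg₁ hg₂ hg₃] with N hN l x c₁ y₁ c₂ y₂ hroot hgood₁ hgood₂ hx₁ hx₂
  obtain ⟨c₁', y₁', hy₁, hc₁, hX₁⟩ := hgood₁.lift hq₁.prime hq₁.coprime_six n₁
  obtain ⟨c₂', y₂', hy₂, hc₂, hX₂⟩ := hgood₂.lift hq₂.prime hq₂.coprime_six n₂
  obtain ⟨k₀, hk₁, hk₂, -⟩ := exists_two_pow_mul_modEq hq₁ hq₂ isLiftPrime_seven h₁₂ h₁₇ h₂₇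
    (a₃ := 1) (b₃ := 2 ^ x) (dvd_sub_of_dvd_sub hx₁ hy₁) (dvd_sub_of_dvd_sub hx₂ hy₂) (by simp)
    (not_dvd_of_dvd_sub hy₁ hgood₁.not_dvd) (not_dvd_of_dvd_sub hy₂ hgood₂.not_dvd)
    (fun h => absurd ((Nat.prime_iff_prime_int.mp isLiftPrime_seven.prime).dvd_of_dvd_pow h)
      (by norm_num))
    (2 * n₁ + 1) (2 * n₂ + 1) 0
  rw [show 2 * n₁ + 1 + 1 = (n₁ + 1) * 2 by ring, pow_mul, hQ₁', ← mul_assoc] at hk₁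
  rw [show 2 * n₂ + 1 + 1 = (n₂ + 1) * 2 by ring, pow_mul, hQ₂', ← mul_assoc] at hk₂
  rw [hQ₁'] at hc₁ hX₁
  rw [hQ₂'] at hc₂ hX₂
  refine hN k₀ l fun k l' m hm hmod => ?_
  set X := remainder N m (Q₁ ^ 2 * Q₂ ^ 2) (e₂ * Q₂ ^ 2) (e₃ * Q₁ ^ 2) 1 (Q₁ ^ 2 * Q₂ ^ 2) with hX
  have hm0 : 0 < m := by have := hs.pos; rw [hm]; positivity
  have hsm : (s : ℤ) ^ l' ∣ m := ⟨2 ^ k, by rw [hm]; push_cast; ring⟩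
  have hd₁ : (Q₁ : ℤ) ^ 2 ∣ (Q₁ ^ 2 * Q₂ ^ 2 : ℕ) := ⟨Q₂ ^ 2, by push_cast; ring⟩
  have hd₂ : (Q₂ : ℤ) ^ 2 ∣ (Q₁ ^ 2 * Q₂ ^ 2 : ℕ) := ⟨Q₁ ^ 2, by push_cast; ring⟩
  have hX₁' : (Q₁ : ℤ) ^ 2 ∣ X - tet c₁' := by
    rw [hX, remainder_swap₁₂]
    exact dvd_remainder_sub h6₁.pow_left hd₁ ⟨e₃, by push_cast; ring⟩ hd₁
      (dvd_mul_sub_of_modEq hmod hd₁ (by exact_mod_cast hk₁)) hX₁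
  have hX₂' : (Q₂ : ℤ) ^ 2 ∣ X - tet c₂' := by
    rw [hX, remainder_swap₁₃]
    exact dvd_remainder_sub h6₂.pow_left ⟨e₂, by push_cast; ring⟩ hd₂ hd₂
      (dvd_mul_sub_of_modEq hmod hd₂ (by exact_mod_cast hk₂)) hX₂
  have hsol := (((tetSol_two_pow (k + 1) X).mul
    (hroot.tetSol_of_dvd_sub hs hs6 (dvd_sub_remainder hs6.pow_left hsm)) h2s.pow h2s.pow).mul
    (tetSol_sq_of_critical h6₁ hc₁ hX₁') (h2Q₁.pow.mul_left hsQ₁.pow)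
    (h2Q₁.pow_left.mul_left hsQ₁.pow_left)).mul (tetSol_sq_of_critical h6₂ hc₂ hX₂')
    ((h2Q₂.pow.mul_left hsQ₂.pow).mul_left hQQ.pow)
    ((h2Q₂.pow_left.mul_left hsQ₂.pow_left).mul_left hQQ)
  obtain ⟨t, ht, hdvd⟩ := hsol.exists_nat (by have := hs.pos; positivity)
  refine ⟨t, ?_, ?_⟩
  · zify
    refine ht.trans_le (le_of_eq ?_)
    rw [hm]; push_cast; ring
  · convert hdvd using 1
    · rw [hm]; push_cast; ring
    · rw [hX, remainder]

theorem two_pow_modEq_of_modEq {q a b : ℕ} (hq : q.Prime) (hq2 : q ≠ 2) (h : a ≡ b [MOD q - 1]) :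
    2 ^ a ≡ 2 ^ b [MOD q] := by
  have hco : Nat.Coprime 2 q := (Nat.coprime_primes Nat.prime_two hq).mpr hq2.symm
  rw [← Nat.totient_prime hq] at h
  have h1 := pow_add_totient_mul_modEq hco a 0
  have h2 := pow_add_totient_mul_modEq hco b 0
  rw [show a % q.totient = b % q.totient from h] at h1
  exact h1.symm.trans h2

theorem dvd_two_pow_mul_sub_two_pow {q s σ β b x l η : ℕ} (hq : q.Prime) (hq2 : q ≠ 2)
    (hs : s ≡ 2 ^ σ [MOD q]) (hβ : β ≡ 2 ^ b [MOD q]) (h : x + σ * l + b ≡ η [MOD q - 1]) :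
    (q : ℤ) ∣ 2 ^ x * (s ^ l * (β : ℕ)) - (2 : ℤ) ^ η := by
  have h1 : 2 ^ x * (s ^ l * β) ≡ 2 ^ η [MOD q] := by
    refine Nat.ModEq.trans ?_ (two_pow_modEq_of_modEq hq hq2 h)
    rw [pow_add, pow_add, mul_assoc, pow_mul]
    exact ((hs.pow l).mul hβ).mul_left _
  have := (Int.natCast_modEq_iff.mpr h1).symm.dvd
  exact_mod_cast this

theorem exists_add_modEq {n₁ n₂ u₁ u₂ η₁ η₂ : ℕ} (hn₁ : 0 < n₁) (hn₂ : 0 < n₂)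
    (h : η₁ + u₂ ≡ η₂ + u₁ [MOD n₁.gcd n₂]) :
    ∃ x, x + u₁ ≡ η₁ [MOD n₁] ∧ x + u₂ ≡ η₂ [MOD n₂] := by
  have e : ∀ {n u η : ℕ}, 0 < n → η + (n - 1) * u + u = η + n * u := by
    intro n u η hn
    obtain ⟨n, rfl⟩ := Nat.exists_eq_succ_of_ne_zero hn.ne'
    simp
    ring
  have key : ∀ {n d u η : ℕ}, 0 < n → d ∣ n → η + (n - 1) * u + u ≡ η [MOD d] := by
    intro n d u η hn hd
    rw [e hn]
    have : n * u ≡ 0 [MOD d] := Nat.modEq_zero_iff_dvd.mpr (hd.mul_right u)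
    simpa using this.add_left η
  have hab : η₁ + (n₁ - 1) * u₁ ≡ η₂ + (n₂ - 1) * u₂ [MOD n₁.gcd n₂] := by
    refine Nat.ModEq.add_right_cancel' (u₁ + u₂) ?_
    have h1 := (key (u := u₁) (η := η₁) hn₁ (Nat.gcd_dvd_left n₁ n₂)).add_right u₂
    have h2 := (key (u := u₂) (η := η₂) hn₂ (Nat.gcd_dvd_right n₁ n₂)).add_right u₁
    rw [← add_assoc, add_comm u₁ u₂, ← add_assoc (η₂ + _)]
    exact h1.trans (h.trans h2.symm)
  obtain ⟨x, hx₁, hx₂⟩ := Nat.chineseRemainder' hab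
  exact ⟨x, (hx₁.add_right _).trans (key hn₁ dvd_rfl), (hx₂.add_right _).trans (key hn₂ dvd_rfl)⟩

theorem isGoodPair_of_zmod {q : ℕ} [NeZero q] {N : ℤ}
    (h : ∃ c : ZMod q, 3 * c ^ 2 - 1 = 0 ∧ ∃ η < q, (2 ^ η : ZMod q) ≠ 0 ∧
      3 * (2 ^ η : ZMod q) ^ 2 - 1 ≠ 0 ∧
      6 * (N : ZMod q) - (c ^ 3 - c) - 2 * ((2 ^ η) ^ 3 - 2 ^ η) = 0) :
    ∃ (c : ℤ) (η : ℕ), IsGoodPair q N c (2 ^ η) := by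
  obtain ⟨c, h1, η, -, h2, h3, h4⟩ := h
  obtain ⟨c, rfl⟩ := ZMod.intCast_surjective c
  refine ⟨c, η, ?_, ?_, ?_, ?_⟩ <;> rw [← ZMod.intCast_zmod_eq_zero_iff_dvd] <;> push_cast <;>
    assumption

theorem hasSimpleRoot_of_zmod {q : ℕ} {N : ℤ}
    (h : ∃ r : ZMod q, 6 * (N : ZMod q) - (r ^ 3 - r) = 0 ∧ 3 * r ^ 2 - 1 ≠ 0) :
    HasSimpleRoot q N := by
  obtain ⟨r, h1, h2⟩ := h
  obtain ⟨r, rfl⟩ := ZMod.intCast_surjective r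
  refine ⟨r, ?_, ?_⟩ <;> rw [← ZMod.intCast_zmod_eq_zero_iff_dvd] <;> push_cast <;> assumption

theorem hasSimpleRoot_of_dvd {p : ℕ} {N : ℤ} (hp : p.Prime) (h : (p : ℤ) ∣ N) :
    HasSimpleRoot p N := by
  refine ⟨0, by simpa using h.mul_left 6, fun h1 => ?_⟩
  exact (Nat.prime_iff_prime_int.mp hp).not_isUnit (isUnit_of_dvd_one (by simpa using h1))

theorem dvd_or_exists_isGoodPair_eleven (N : ℤ) :
    (11 : ℤ) ∣ N ∨ ∃ (c : ℤ) (η : ℕ), IsGoodPair 11 N c (2 ^ η) := by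
  have : ∀ N : ZMod 11, N = 0 ∨ ∃ c : ZMod 11, 3 * c ^ 2 - 1 = 0 ∧ ∃ η < 11,
      (2 ^ η : ZMod 11) ≠ 0 ∧ 3 * (2 ^ η : ZMod 11) ^ 2 - 1 ≠ 0 ∧
      6 * N - (c ^ 3 - c) - 2 * ((2 ^ η) ^ 3 - 2 ^ η) = 0 := by decide +kernel
  exact (this N).imp (ZMod.intCast_zmod_eq_zero_iff_dvd N 11).mp isGoodPair_of_zmod

theorem dvd_or_exists_isGoodPair_thirteen (N : ℤ) :
    (13 : ℤ) ∣ N ∨ ∃ (c : ℤ) (η : ℕ), IsGoodPair 13 N c (2 ^ η) := by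
  have : ∀ N : ZMod 13, N = 0 ∨ ∃ c : ZMod 13, 3 * c ^ 2 - 1 = 0 ∧ ∃ η < 13,
      (2 ^ η : ZMod 13) ≠ 0 ∧ 3 * (2 ^ η : ZMod 13) ^ 2 - 1 ≠ 0 ∧
      6 * N - (c ^ 3 - c) - 2 * ((2 ^ η) ^ 3 - 2 ^ η) = 0 := by decide +kernel
  exact (this N).imp (ZMod.intCast_zmod_eq_zero_iff_dvd N 13).mp isGoodPair_of_zmod

theorem hasSimpleRoot_or_exists_isGoodPair_thirty_seven (N : ℤ) :
    HasSimpleRoot 37 N ∨ ∃ (c : ℤ) (η : ℕ), IsGoodPair 37 N c (2 ^ η) := by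
  have : ∀ N : ZMod 37, (∃ r : ZMod 37, 6 * N - (r ^ 3 - r) = 0 ∧ 3 * r ^ 2 - 1 ≠ 0) ∨
      ∃ c : ZMod 37, 3 * c ^ 2 - 1 = 0 ∧ ∃ η < 37,
      (2 ^ η : ZMod 37) ≠ 0 ∧ 3 * (2 ^ η : ZMod 37) ^ 2 - 1 ≠ 0 ∧
      6 * N - (c ^ 3 - c) - 2 * ((2 ^ η) ^ 3 - 2 ^ η) = 0 := by decide +kernel
  exact (this N).imp hasSimpleRoot_of_zmod isGoodPair_of_zmod

theorem hasSimpleRoot_seven_or (N : ℤ) : HasSimpleRoot 7 N ∨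
    ∃ ε < 2, (7 : ℤ) ∣ 6 * N - 2 * ((2 * (-1) ^ ε) ^ 3 - 2 * (-1) ^ ε) := by
  have : ∀ N : ZMod 7, (∃ r : ZMod 7, 6 * N - (r ^ 3 - r) = 0 ∧ 3 * r ^ 2 - 1 ≠ 0) ∨
      ∃ ε < 2, 6 * N - 2 * ((2 * (-1) ^ ε) ^ 3 - 2 * (-1) ^ ε) = 0 := by decide +kernel
  refine (this N).imp hasSimpleRoot_of_zmod fun ⟨ε, hε, h⟩ => ⟨ε, hε, ?_⟩
  rw [show (7 : ℤ) = (7 : ℕ) from rfl, ← ZMod.intCast_zmod_eq_zero_iff_dvd]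
  push_cast
  exact h

theorem eventually_of_thirty_seven : ∀ᶠ N : ℕ in atTop, ∀ (c₁ c₂ : ℤ) (η₁ η₂ : ℕ),
    HasSimpleRoot 37 N → IsGoodPair 11 N c₁ (2 ^ η₁) → IsGoodPair 13 N c₂ (2 ^ η₂) →
    IsSumSevenTet N := by
  filter_upwards [eventually_isSumSevenTet_of_pair (s := 37) (n₁ := 0) (n₂ := 0) (Q₁ := 11)
    (Q₂ := 13) (by norm_num) (by norm_num) isLiftPrime_eleven isLiftPrime_thirteen (by norm_num)
    (by norm_num) (by norm_num) (by norm_num) (by norm_num) representsClass_one_two_four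
    (by norm_num) (by norm_num) (by norm_num) (by norm_num) (by norm_num) (by norm_num)
    (by norm_num)] with N hN c₁ c₂ η₁ η₂ h h₁ h₂
  obtain ⟨x, hx₁, hx₂⟩ := exists_add_modEq (n₁ := 10) (n₂ := 12)
    (u₁ := 2 * (η₁ + η₂ + 1) + 3) (u₂ := 7 * (η₁ + η₂ + 1) + 4) (η₁ := η₁) (η₂ := η₂)
    (by norm_num) (by norm_num) (by change _ % 2 = _ % 2; omega)
  exact hN (η₁ + η₂ + 1) x _ _ _ _ h h₁ h₂
    (dvd_two_pow_mul_sub_two_pow (σ := 2) (b := 3) (by norm_num) (by norm_num) (by decide)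
      (by decide) (by rwa [add_assoc]))
    (dvd_two_pow_mul_sub_two_pow (σ := 7) (b := 4) (by norm_num) (by norm_num) (by decide)
      (by decide) (by rwa [add_assoc]))

theorem eventually_of_eleven : ∀ᶠ N : ℕ in atTop, ∀ (c₁ c₂ : ℤ) (η₁ η₂ : ℕ),
    HasSimpleRoot 11 N → IsGoodPair 13 N c₁ (2 ^ η₁) → IsGoodPair 37 N c₂ (2 ^ η₂) →
    IsSumSevenTet N := by
  filter_upwards [eventually_isSumSevenTet_of_pair (s := 11) (n₁ := 2) (n₂ := 1) (Q₁ := 13 ^ 3)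
    (Q₂ := 37 ^ 2) (by norm_num) (by norm_num) isLiftPrime_thirteen isLiftPrime_thirty_seven
    (by norm_num) (by norm_num) (by norm_num) (by norm_num) (by norm_num)
    representsClass_one_two_four.swap₂₃ (by norm_num) (by norm_num) (by norm_num) (by norm_num)
    (by norm_num) (by norm_num) (by norm_num)] with N hN c₁ c₂ η₁ η₂ h h₁ h₂
  obtain ⟨x, hx₁, hx₂⟩ := exists_add_modEq (n₁ := 12) (n₂ := 36)
    (u₁ := 7 * (η₁ + 11 * η₂ + 1) + 6) (u₂ := 30 * (η₁ + 11 * η₂ + 1) + 31) (η₁ := η₁) (η₂ := η₂)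
    (by norm_num) (by norm_num) (by change _ % 12 = _ % 12; omega)
  exact hN (η₁ + 11 * η₂ + 1) x _ _ _ _ h h₁ h₂
    (dvd_two_pow_mul_sub_two_pow (σ := 7) (b := 6) (by norm_num) (by norm_num) (by decide)
      (by decide) (by rwa [add_assoc]))
    (dvd_two_pow_mul_sub_two_pow (σ := 30) (b := 31) (by norm_num) (by norm_num) (by decide)
      (by decide) (by rwa [add_assoc]))

theorem eventually_of_thirteen_of_odd_add : ∀ᶠ N : ℕ in atTop, ∀ (c₁ c₂ : ℤ) (η₁ η₂ : ℕ),
    HasSimpleRoot 13 N → IsGoodPair 11 N c₁ (2 ^ η₁) → IsGoodPair 37 N c₂ (2 ^ η₂) →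
    Odd (η₁ + η₂) → IsSumSevenTet N := by
  filter_upwards [eventually_isSumSevenTet_of_pair (s := 13) (n₁ := 11) (n₂ := 7) (Q₁ := 11 ^ 12)
    (Q₂ := 37 ^ 8) (by norm_num) (by norm_num) isLiftPrime_eleven isLiftPrime_thirty_seven
    (by norm_num) (by norm_num) (by norm_num) (by norm_num) (by norm_num)
    representsClass_one_two_four (by norm_num) (by norm_num) (by norm_num) (by norm_num)
    (by norm_num) (by norm_num) (by norm_num)] with N hN c₁ c₂ η₁ η₂ h h₁ h₂ hodd
  rw [Nat.odd_iff] at hodd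
  obtain ⟨x, hx₁, hx₂⟩ := exists_add_modEq (n₁ := 10) (n₂ := 36)
    (u₁ := 1 * 0 + 3) (u₂ := 11 * 0 + 2) (η₁ := η₁) (η₂ := η₂)
    (by norm_num) (by norm_num) (by change _ % 2 = _ % 2; omega)
  exact hN 0 x _ _ _ _ h h₁ h₂
    (dvd_two_pow_mul_sub_two_pow (σ := 1) (b := 3) (by norm_num) (by norm_num) (by decide)
      (by decide) (by rwa [add_assoc]))
    (dvd_two_pow_mul_sub_two_pow (σ := 11) (b := 2) (by norm_num) (by norm_num) (by decide)
      (by decide) (by rwa [add_assoc]))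

theorem exists_steering_forty_nine {H : ℤ} (hH : (7 : ℤ) ∣ H ^ 2 - 4) :
    ∀ c : ZMod 49, ∃ σ < 43, (c + H * (σ : ℕ)) ^ 3 = c + H * σ := by
  have key : ∀ h : ZMod 49, 7 * (h ^ 2 - 4) = 0 →
      ∀ c : ZMod 49, ∃ σ < 43, (c + h * (σ : ℕ)) ^ 3 = c + h * σ := by decide +kernel
  refine key H ?_
  have h : ((49 : ℕ) : ℤ) ∣ 7 * (H ^ 2 - 4) := mul_dvd_mul_left 7 hH
  rw [← ZMod.intCast_zmod_eq_zero_iff_dvd] at h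
  exact_mod_cast h

theorem eventually_isSumSevenTet_of_pair_of_steering {s q₁ q₂ n₁ n₂ Q₁ Q₂ : ℕ} (hs : s.Prime)
    (hs6 : IsCoprime (s : ℤ) 6) (hq₁ : IsLiftPrime q₁) (hq₂ : IsLiftPrime q₂) (hs₁ : s ≠ q₁)
    (hs₂ : s ≠ q₂) (h₁₂ : q₁ ≠ q₂) (hs₇ : s ≠ 7) (h₁₇ : q₁ ≠ 7) (h₂₇ : q₂ ≠ 7)
    (hQ₁ : q₁ ^ (n₁ + 1) = Q₁) (hQ₂ : q₂ ^ (n₂ + 1) = Q₂)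
    (hQ₁₇ : (7 : ℤ) ∣ Q₁ - 1) (hQ₂₇ : (7 : ℤ) ∣ Q₂ - 1)
    (hg₁ : (43 * 16 * (Q₁ * Q₂)) ^ 3 < 6 * (2 * (Q₁ ^ 2 * Q₂ ^ 2)) ^ 3)
    (hg₂ : (43 * 16 * (Q₁ * Q₂)) ^ 3 < 6 * (196 * Q₂ ^ 2) ^ 3)
    (hg₃ : (43 * 16 * (Q₁ * Q₂)) ^ 3 < 6 * (784 * Q₁ ^ 2) ^ 3) :
    ∀ᶠ N : ℕ in atTop, ∀ (l x : ℕ) (c₁ y₁ c₂ y₂ y₃ : ℤ), HasSimpleRoot s N →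
      IsGoodPair q₁ N c₁ y₁ → IsGoodPair q₂ N c₂ y₂ → y₃ ^ 2 = 4 →
      (7 : ℤ) ∣ 6 * N - 2 * (y₃ ^ 3 - y₃) →
      (q₁ : ℤ) ∣ 2 ^ x * (s ^ l * (196 * Q₂ ^ 2 : ℕ)) - y₁ →
      (q₂ : ℤ) ∣ 2 ^ x * (s ^ l * (784 * Q₁ ^ 2 : ℕ)) - y₂ →
      (7 : ℤ) ∣ 2 ^ x * (s ^ l * (2 * (Q₁ ^ 2 * Q₂ ^ 2) : ℕ)) - y₃ → IsSumSevenTet N := by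
  have hq₁0 := hq₁.prime.pos
  have hq₂0 := hq₂.prime.pos
  have hQ₁0 : 0 < Q₁ := by rw [← hQ₁]; positivity
  have hQ₂0 : 0 < Q₂ := by rw [← hQ₂]; positivity
  have hQ₁' : (q₁ : ℤ) ^ (n₁ + 1) = Q₁ := by rw [← hQ₁]; push_cast; rfl
  have hQ₂' : (q₂ : ℤ) ^ (n₂ + 1) = Q₂ := by rw [← hQ₂]; push_cast; rfl
  have h6₁ : IsCoprime (Q₁ : ℤ) 6 := hQ₁' ▸ hq₁.coprime_six.pow_left
  have h6₂ : IsCoprime (Q₂ : ℤ) 6 := hQ₂' ▸ hq₂.coprime_six.pow_left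
  have h6₇ : IsCoprime (49 : ℤ) 6 := by norm_num
  have h2Q₁ := (isCoprime_two_of_isCoprime_six h6₁).symm
  have h2Q₂ := (isCoprime_two_of_isCoprime_six h6₂).symm
  have h2s := (isCoprime_two_of_isCoprime_six hs6).symm
  have hsQ₁ : IsCoprime (s : ℤ) Q₁ := hQ₁' ▸ (isCoprime_of_primes hs hq₁.prime hs₁).pow_right
  have hsQ₂ : IsCoprime (s : ℤ) Q₂ := hQ₂' ▸ (isCoprime_of_primes hs hq₂.prime hs₂).pow_right
  have hQQ : IsCoprime (Q₁ : ℤ) Q₂ := by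
    rw [← hQ₁', ← hQ₂']
    exact (isCoprime_of_primes hq₁.prime hq₂.prime h₁₂).pow
  have e49 : (49 : ℤ) = (7 : ℕ) ^ 2 := by norm_num
  have hs49 : IsCoprime (s : ℤ) 49 :=
    e49 ▸ (isCoprime_of_primes hs Nat.prime_seven hs₇).pow_right
  have h249 : IsCoprime (2 : ℤ) 49 := by norm_num
  have hQ₁49 : IsCoprime (Q₁ : ℤ) 49 := by
    rw [e49, ← hQ₁']
    exact (isCoprime_of_primes hq₁.prime Nat.prime_seven h₁₇).pow
  have hQ₂49 : IsCoprime (Q₂ : ℤ) 49 := by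
    rw [e49, ← hQ₂']
    exact (isCoprime_of_primes hq₂.prime Nat.prime_seven h₂₇).pow
  have hcop : (2 * s).Coprime (49 * (Q₁ ^ 2 * Q₂ ^ 2)) := by
    refine Nat.isCoprime_iff_coprime.mp ?_
    push_cast
    exact (h249.mul_left hs49).mul_right
      (((h2Q₁.mul_left hsQ₁).pow_right).mul_right ((h2Q₂.mul_left hsQ₂).pow_right))
  filter_upwards [eventually_isSumSevenTet (μ := 196 * (Q₁ ^ 2 * Q₂ ^ 2))
    (g := 43 * 16 * (Q₁ * Q₂)) (β₁ := 2 * (Q₁ ^ 2 * Q₂ ^ 2)) (β₂ := 196 * Q₂ ^ 2)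
    (β₃ := 784 * Q₁ ^ 2) (c₁ := 14) (c₂ := Q₁) (c₃ := Q₂) (odd_of_isCoprime_six hs6) hs.one_lt
    hcop (by positivity) representsClass_one_two_four.swap₁₂ (by norm_num) (by positivity)
    (by positivity) (by positivity) (by positivity) (by ring) (by ring) (by ring) hg₁ hg₂ hg₃]
    with N hN l x c₁ y₁ c₂ y₂ y₃ hroot hgood₁ hgood₂ hy₃4 hy₃ hx₁ hx₂ hx₃
  have hy₃7 : ¬ ((7 : ℕ) : ℤ) ∣ y₃ := fun h => by
    have := h.mul_right y₃
    rw [← pow_two, hy₃4] at this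
    norm_num at this
  obtain ⟨c₁', y₁', hy₁, hc₁, hX₁⟩ := hgood₁.lift hq₁.prime hq₁.coprime_six n₁
  obtain ⟨c₂', y₂', hy₂, hc₂, hX₂⟩ := hgood₂.lift hq₂.prime hq₂.coprime_six n₂
  obtain ⟨y₃', hy₃', hX₃⟩ := exists_pow_dvd_sub_two_mul_tet Nat.prime_seven
    isLiftPrime_seven.coprime_six (X := N) (y₀ := y₃) (by rw [hy₃4]; norm_num) hy₃ 1
  obtain ⟨k₀, hk₁, hk₂, hk₃⟩ := exists_two_pow_mul_modEq hq₁ hq₂ isLiftPrime_seven h₁₂ h₁₇ h₂₇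
    (dvd_sub_of_dvd_sub hx₁ hy₁) (dvd_sub_of_dvd_sub hx₂ hy₂) (dvd_sub_of_dvd_sub hx₃ hy₃')
    (not_dvd_of_dvd_sub hy₁ hgood₁.not_dvd) (not_dvd_of_dvd_sub hy₂ hgood₂.not_dvd)
    (not_dvd_of_dvd_sub hy₃' hy₃7) (2 * n₁ + 1) (2 * n₂ + 1) 1
  rw [show 2 * n₁ + 1 + 1 = (n₁ + 1) * 2 by ring, pow_mul, hQ₁', ← mul_assoc] at hk₁
  rw [show 2 * n₂ + 1 + 1 = (n₂ + 1) * 2 by ring, pow_mul, hQ₂', ← mul_assoc] at hk₂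
  rw [← mul_assoc] at hk₃
  rw [show ((7 : ℕ) : ℤ) ^ (1 + 1) = 49 by norm_num] at hk₃ hX₃
  rw [hQ₁'] at hc₁ hX₁
  rw [hQ₂'] at hc₂ hX₂
  refine hN k₀ l fun k l' m hm hmod => ?_
  set X := remainder N m (2 * (Q₁ ^ 2 * Q₂ ^ 2)) (196 * Q₂ ^ 2) (784 * Q₁ ^ 2) 1
    (196 * (Q₁ ^ 2 * Q₂ ^ 2)) with hX
  have hm0 : 0 < m := by have := hs.pos; rw [hm]; positivity
  have hsm : (s : ℤ) ^ l' ∣ m := ⟨2 ^ k, by rw [hm]; push_cast; ring⟩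
  have hX₁' : (Q₁ : ℤ) ^ 2 ∣ X - tet c₁' := by
    rw [hX, remainder_swap₁₂]
    exact dvd_remainder_sub h6₁.pow_left ⟨2 * Q₂ ^ 2, by push_cast; ring⟩
      ⟨784, by push_cast; ring⟩ ⟨196 * Q₂ ^ 2, by push_cast; ring⟩
      (dvd_mul_sub_of_modEq hmod ⟨49 * Q₂ ^ 2, by push_cast; ring⟩ (by exact_mod_cast hk₁)) hX₁
  have hX₂' : (Q₂ : ℤ) ^ 2 ∣ X - tet c₂' := by
    rw [hX, remainder_swap₁₃]
    exact dvd_remainder_sub h6₂.pow_left ⟨196, by push_cast; ring⟩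
      ⟨2 * Q₁ ^ 2, by push_cast; ring⟩ ⟨196 * Q₁ ^ 2, by push_cast; ring⟩
      (dvd_mul_sub_of_modEq hmod ⟨49 * Q₁ ^ 2, by push_cast; ring⟩ (by exact_mod_cast hk₂)) hX₂
  have hmy₃ : (49 : ℤ) ∣ m * (2 * (Q₁ ^ 2 * Q₂ ^ 2) : ℕ) - y₃' :=
    dvd_mul_sub_of_modEq hmod ⟨Q₁ ^ 2 * Q₂ ^ 2, by push_cast; ring⟩ (by exact_mod_cast hk₃)
  have hX₃' : (49 : ℤ) ∣ X := by
    have := dvd_remainder_sub (N := N) (c := 0) (m := m) (β₁ := 2 * (Q₁ ^ 2 * Q₂ ^ 2))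
      (β₂ := 196 * Q₂ ^ 2) (β₃ := 784 * Q₁ ^ 2) (r := 1) (μ := 196 * (Q₁ ^ 2 * Q₂ ^ 2)) h6₇
      ⟨4 * Q₂ ^ 2, by push_cast; ring⟩ ⟨16 * Q₁ ^ 2, by push_cast; ring⟩
      ⟨4 * (Q₁ ^ 2 * Q₂ ^ 2), by push_cast; ring⟩ hmy₃ (by simpa using hX₃)
    simpa using this
  have hH7 : (7 : ℤ) ∣ ((16 * m * Q₁ * Q₂ : ℤ)) ^ 2 - 4 := by
    have h := (Dvd.dvd.trans (by norm_num) hmy₃ : (7 : ℤ) ∣ _)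
    have h' : (7 : ℤ) ∣ m * (2 * (Q₁ ^ 2 * Q₂ ^ 2) : ℕ) - y₃ := by
      have := dvd_add h hy₃'
      rwa [sub_add_sub_cancel] at this
    rw [show (7 : ℤ) = (7 : ℕ) from rfl, ← ZMod.intCast_zmod_eq_zero_iff_dvd] at h' hQ₁₇ hQ₂₇ ⊢
    have hy4 := congrArg (Int.cast : ℤ → ZMod 7) hy₃4
    push_cast at h' hQ₁₇ hQ₂₇ hy4 ⊢
    rw [sub_eq_zero] at h' hQ₁₇ hQ₂₇
    rw [hQ₁₇, hQ₂₇] at h' ⊢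
    rw [← h'] at hy4
    have h252 : (252 : ZMod 7) = 0 := by decide
    linear_combination 64 * hy4 + h252
  have hsol := (((tetSol_two_pow (k + 3) X).mul
    (hroot.tetSol_of_dvd_sub hs hs6 (dvd_sub_remainder hs6.pow_left hsm)) h2s.pow h2s.pow).mul
    (tetSol_sq_of_critical h6₁ hc₁ hX₁') (h2Q₁.pow.mul_left hsQ₁.pow)
    (h2Q₁.pow_left.mul_left hsQ₁.pow_left)).mul (tetSol_sq_of_critical h6₂ hc₂ hX₂')
    ((h2Q₂.pow.mul_left hsQ₂.pow).mul_left hQQ.pow)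
    ((h2Q₂.pow_left.mul_left hsQ₂.pow_left).mul_left hQQ)
  have hH : (2 ^ (k + 3 + 1) * s ^ l' * Q₁ * Q₂ : ℤ) = 16 * m * Q₁ * Q₂ := by
    rw [hm]; push_cast; ring
  rw [hH] at hsol
  obtain ⟨t, ht, hdvd⟩ := hsol.exists_nat_of_steering (n := 49) (by positivity)
    (((h249.pow_left.mul_left hs49.pow_left).mul_left hQ₁49.pow_left).mul_left hQ₂49.pow_left) h6₇
    hX₃' (by simp) (exists_steering_forty_nine hH7)
  refine ⟨t, ?_, ?_⟩
  · zify
    refine ht.trans_le (le_of_eq ?_)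
    push_cast; ring
  · convert hdvd using 1
    · rw [hm]; push_cast; ring
    · rw [hX, remainder]

theorem eventually_of_thirteen_of_even_add : ∀ᶠ N : ℕ in atTop, ∀ (c₁ c₂ : ℤ) (η₁ η₂ ε : ℕ),
    HasSimpleRoot 13 N → IsGoodPair 11 N c₁ (2 ^ η₁) → IsGoodPair 37 N c₂ (2 ^ η₂) →
    Even (η₁ + η₂) → (7 : ℤ) ∣ 6 * N - 2 * ((2 * (-1) ^ ε) ^ 3 - 2 * (-1) ^ ε) →
    IsSumSevenTet N := by
  filter_upwards [eventually_isSumSevenTet_of_pair_of_steering (s := 13) (n₁ := 71) (n₂ := 47)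
    (Q₁ := 11 ^ 72) (Q₂ := 37 ^ 48) (by norm_num) (by norm_num) isLiftPrime_eleven
    isLiftPrime_thirty_seven (by norm_num) (by norm_num) (by norm_num) (by norm_num) (by norm_num)
    (by norm_num) (by norm_num) (by norm_num) (by norm_num) (by norm_num) (by norm_num)
    (by norm_num) (by norm_num)] with N hN c₁ c₂ η₁ η₂ ε h h₁ h₂ heven h₇
  rw [Nat.even_iff] at heven
  obtain ⟨x, hx₁, hx₂⟩ := exists_add_modEq (n₁ := 10) (n₂ := 36)
    (u₁ := 1 * (3 * ε + 8 * η₂ + 8) + 8) (u₂ := 11 * (3 * ε + 8 * η₂ + 8) + 32)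
    (η₁ := η₁) (η₂ := η₂) (by norm_num) (by norm_num) (by change _ % 2 = _ % 2; omega)
  have hx₃ : 3 ∣ x := by
    have : (x + (11 * (3 * ε + 8 * η₂ + 8) + 32)) % 36 = η₂ % 36 := hx₂
    omega
  obtain ⟨x, rfl⟩ := hx₃
  refine hN (3 * ε + 8 * η₂ + 8) (3 * x) _ _ _ _ _ h h₁ h₂ ?_ h₇
    (dvd_two_pow_mul_sub_two_pow (σ := 1) (b := 8) (by norm_num) (by norm_num) (by decide)
      (by decide) (by rwa [add_assoc]))
    (dvd_two_pow_mul_sub_two_pow (σ := 11) (b := 32) (by norm_num) (by norm_num) (by decide)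
      (by decide) (by rwa [add_assoc])) ?_
  · rw [mul_pow, ← pow_mul, mul_comm ε, pow_mul]; norm_num
  · have h2 : (2 : ZMod 7) ^ 3 = 1 := by decide
    have h13 : (13 : ZMod 7) = -1 := by decide
    have hQ : ((2 * ((11 ^ 72) ^ 2 * (37 ^ 48) ^ 2) : ℕ) : ZMod 7) = 2 := by
      rw [show (2 : ZMod 7) = (2 : ℕ) from rfl, ZMod.natCast_eq_natCast_iff]
      decide
    rw [show (7 : ℤ) = (7 : ℕ) from rfl, ← ZMod.intCast_zmod_eq_zero_iff_dvd, Int.cast_sub,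
      Int.cast_mul, Int.cast_mul, Int.cast_natCast, hQ]
    push_cast
    rw [h13, pow_mul, h2, show 3 * ε + 8 * η₂ + 8 = 2 * (ε + 4 * η₂ + 4) + ε by ring, pow_add,
      pow_mul]
    norm_num
    ring

theorem eventually_isSumSevenTet_of_triple {q₁ q₂ q₃ e₁ e₂ e₃ v r : ℕ} (hq₁ : IsLiftPrime q₁)
    (hq₂ : IsLiftPrime q₂) (hq₃ : IsLiftPrime q₃) (h₁₂ : q₁ ≠ q₂) (h₁₃ : q₁ ≠ q₃) (h₂₃ : q₂ ≠ q₃)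
    (hform : RepresentsClass e₁ e₂ e₃ (2 ^ v) r) (hr : r < 2 ^ v) (he₁ : 0 < e₁) (he₂ : 0 < e₂)
    (he₃ : 0 < e₃)
    (hg₁ : (6 * 2 ^ v * (q₁ * q₂ * q₃)) ^ 3 < 6 * (e₁ * (q₂ ^ 2 * q₃ ^ 2)) ^ 3)
    (hg₂ : (6 * 2 ^ v * (q₁ * q₂ * q₃)) ^ 3 < 6 * (e₂ * (q₁ ^ 2 * q₃ ^ 2)) ^ 3)
    (hg₃ : (6 * 2 ^ v * (q₁ * q₂ * q₃)) ^ 3 < 6 * (e₃ * (q₁ ^ 2 * q₂ ^ 2)) ^ 3) :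
    ∀ᶠ N : ℕ in atTop, ∀ (l x : ℕ) (c₁ y₁ c₂ y₂ c₃ y₃ : ℤ), IsGoodPair q₁ N c₁ y₁ →
      IsGoodPair q₂ N c₂ y₂ → IsGoodPair q₃ N c₃ y₃ →
      (q₁ : ℤ) ∣ 2 ^ x * ((3 : ℕ) ^ l * (e₁ * (q₂ ^ 2 * q₃ ^ 2) : ℕ)) - y₁ →
      (q₂ : ℤ) ∣ 2 ^ x * ((3 : ℕ) ^ l * (e₂ * (q₁ ^ 2 * q₃ ^ 2) : ℕ)) - y₂ →
      (q₃ : ℤ) ∣ 2 ^ x * ((3 : ℕ) ^ l * (e₃ * (q₁ ^ 2 * q₂ ^ 2) : ℕ)) - y₃ →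
      IsSumSevenTet N := by
  have hq₁0 := hq₁.prime.pos
  have hq₂0 := hq₂.prime.pos
  have hq₃0 := hq₃.prime.pos
  have h₁6 := hq₁.coprime_six
  have h₂6 := hq₂.coprime_six
  have h₃6 := hq₃.coprime_six
  have three : ∀ {q : ℕ}, IsCoprime (q : ℤ) 6 → IsCoprime (3 : ℤ) q := fun h =>
    (IsCoprime.of_mul_right_right (y := 2) (by norm_num; exact h)).symm
  have h2₁ := (isCoprime_two_of_isCoprime_six h₁6).symm
  have h2₂ := (isCoprime_two_of_isCoprime_six h₂6).symm
  have h2₃ := (isCoprime_two_of_isCoprime_six h₃6).symm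
  have h12 := isCoprime_of_primes hq₁.prime hq₂.prime h₁₂
  have h13 := isCoprime_of_primes hq₁.prime hq₃.prime h₁₃
  have h23 := isCoprime_of_primes hq₂.prime hq₃.prime h₂₃
  have h2three : IsCoprime (2 : ℤ) 3 := by norm_num
  have hcop : (2 * 3).Coprime (q₁ ^ 2 * q₂ ^ 2 * q₃ ^ 2) := by
    refine Nat.isCoprime_iff_coprime.mp ?_
    push_cast
    exact ((((h2₁.mul_left (three h₁6)).pow_right).mul_right
      ((h2₂.mul_left (three h₂6)).pow_right)).mul_right ((h2₃.mul_left (three h₃6)).pow_right))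
  filter_upwards [eventually_isSumSevenTet (s := 3) (μ := q₁ ^ 2 * q₂ ^ 2 * q₃ ^ 2)
    (g := 6 * 2 ^ v * (q₁ * q₂ * q₃)) (β₁ := e₁ * (q₂ ^ 2 * q₃ ^ 2))
    (β₂ := e₂ * (q₁ ^ 2 * q₃ ^ 2)) (β₃ := e₃ * (q₁ ^ 2 * q₂ ^ 2)) (c₁ := q₁) (c₂ := q₂)
    (c₃ := q₃) (by decide) (by norm_num) hcop (by positivity) hform hr
    (by positivity) (by positivity) (by positivity) (by positivity) (by ring) (by ring)
    (by ring) hg₁ hg₂ hg₃] with N hN l x c₁ y₁ c₂ y₂ c₃ y₃ hgood₁ hgood₂ hgood₃ hx₁ hx₂ hx₃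
  obtain ⟨c₁', y₁', hy₁, hc₁, hX₁⟩ := hgood₁.lift hq₁.prime hq₁.coprime_six 0
  obtain ⟨c₂', y₂', hy₂, hc₂, hX₂⟩ := hgood₂.lift hq₂.prime hq₂.coprime_six 0
  obtain ⟨c₃', y₃', hy₃, hc₃, hX₃⟩ := hgood₃.lift hq₃.prime hq₃.coprime_six 0
  obtain ⟨k₀, hk₁, hk₂, hk₃⟩ := exists_two_pow_mul_modEq hq₁ hq₂ hq₃ h₁₂ h₁₃ h₂₃
    (dvd_sub_of_dvd_sub hx₁ hy₁) (dvd_sub_of_dvd_sub hx₂ hy₂) (dvd_sub_of_dvd_sub hx₃ hy₃)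
    (not_dvd_of_dvd_sub hy₁ hgood₁.not_dvd) (not_dvd_of_dvd_sub hy₂ hgood₂.not_dvd)
    (not_dvd_of_dvd_sub hy₃ hgood₃.not_dvd) 1 1 1
  rw [← mul_assoc, one_add_one_eq_two] at hk₁ hk₂ hk₃
  rw [zero_add, pow_one] at hc₁ hX₁ hc₂ hX₂ hc₃ hX₃
  refine hN k₀ l fun k l' m hm hmod => ?_
  set X := remainder N m (e₁ * (q₂ ^ 2 * q₃ ^ 2)) (e₂ * (q₁ ^ 2 * q₃ ^ 2))
    (e₃ * (q₁ ^ 2 * q₂ ^ 2)) r (q₁ ^ 2 * q₂ ^ 2 * q₃ ^ 2) with hX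
  have hd₁ : (q₁ : ℤ) ^ 2 ∣ (q₁ ^ 2 * q₂ ^ 2 * q₃ ^ 2 : ℕ) := ⟨q₂ ^ 2 * q₃ ^ 2, by push_cast; ring⟩
  have hd₂ : (q₂ : ℤ) ^ 2 ∣ (q₁ ^ 2 * q₂ ^ 2 * q₃ ^ 2 : ℕ) := ⟨q₁ ^ 2 * q₃ ^ 2, by push_cast; ring⟩
  have hd₃ : (q₃ : ℤ) ^ 2 ∣ (q₁ ^ 2 * q₂ ^ 2 * q₃ ^ 2 : ℕ) := ⟨q₁ ^ 2 * q₂ ^ 2, by push_cast; ring⟩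
  have hX₁' : (q₁ : ℤ) ^ 2 ∣ X - tet c₁' :=
    dvd_remainder_sub h₁6.pow_left ⟨e₂ * q₃ ^ 2, by push_cast; ring⟩
      ⟨e₃ * q₂ ^ 2, by push_cast; ring⟩ hd₁
      (dvd_mul_sub_of_modEq hmod hd₁ (by exact_mod_cast hk₁)) hX₁
  have hX₂' : (q₂ : ℤ) ^ 2 ∣ X - tet c₂' := by
    rw [hX, remainder_swap₁₂]
    exact dvd_remainder_sub h₂6.pow_left ⟨e₁ * q₃ ^ 2, by push_cast; ring⟩
      ⟨e₃ * q₁ ^ 2, by push_cast; ring⟩ hd₂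
      (dvd_mul_sub_of_modEq hmod hd₂ (by exact_mod_cast hk₂)) hX₂
  have hX₃' : (q₃ : ℤ) ^ 2 ∣ X - tet c₃' := by
    rw [hX, remainder_swap₁₃]
    exact dvd_remainder_sub h₃6.pow_left ⟨e₂ * q₁ ^ 2, by push_cast; ring⟩
      ⟨e₁ * q₂ ^ 2, by push_cast; ring⟩ hd₃
      (dvd_mul_sub_of_modEq hmod hd₃ (by exact_mod_cast hk₃)) hX₃
  have hsol := ((((tetSol_two_pow (k + v) X).mul (tetSol_three_pow l' X)
    h2three.pow h2three.pow).mul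
    (tetSol_sq_of_critical h₁6 hc₁ hX₁') (h2₁.pow.mul_left (three h₁6).pow)
    (h2₁.pow_left.mul_left (three h₁6).pow_left)).mul
    (tetSol_sq_of_critical h₂6 hc₂ hX₂')
    ((h2₂.pow.mul_left (three h₂6).pow).mul_left h12.pow)
    ((h2₂.pow_left.mul_left (three h₂6).pow_left).mul_left h12)).mul
    (tetSol_sq_of_critical h₃6 hc₃ hX₃')
    (((h2₃.pow.mul_left (three h₃6).pow).mul_left h13.pow).mul_left h23.pow)
    (((h2₃.pow_left.mul_left (three h₃6).pow_left).mul_left h13).mul_left h23)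
  obtain ⟨t, ht, hdvd⟩ := hsol.exists_nat (by positivity)
  refine ⟨t, ?_, ?_⟩
  · zify
    refine ht.trans_le (le_of_eq ?_)
    rw [hm]; push_cast; ring
  · convert hdvd using 1
    · rw [hm]; push_cast; ring
    · rw [hX, remainder]

theorem exists_add_modEq_triple {b₁ b₂ b₃ η₁ η₂ η₃ : ℕ} (h₁₃ : Even (b₁ + b₃ + (η₁ + η₃)))
    (h₂₃ : Even (b₂ + b₃ + (η₂ + η₃))) :
    ∃ l x, x + 8 * l + b₁ ≡ η₁ [MOD 10] ∧ x + 4 * l + b₂ ≡ η₂ [MOD 12] ∧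
      x + 26 * l + b₃ ≡ η₃ [MOD 36] := by
  obtain ⟨d, hd⟩ := h₂₃
  rw [Nat.even_iff] at h₁₃
  set l := d + 5 * b₂ + 5 * η₃ with hl
  obtain ⟨x, hx₁, hx₃⟩ := exists_add_modEq (n₁ := 10) (n₂ := 36) (u₁ := 8 * l + b₁)
    (u₂ := 26 * l + b₃) (η₁ := η₁) (η₂ := η₃) (by norm_num) (by norm_num)
    (by change _ % 2 = _ % 2; omega)
  refine ⟨l, x, by rwa [add_assoc], ?_, by rwa [add_assoc]⟩
  change _ % _ = _ % _ at hx₃ ⊢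
  omega

theorem eventually_of_parity {e₁ e₂ e₃ v r b₁ b₂ b₃ : ℕ}
    (hform : RepresentsClass e₁ e₂ e₃ (2 ^ v) r) (hr : r < 2 ^ v) (he₁ : 0 < e₁) (he₂ : 0 < e₂)
    (he₃ : 0 < e₃)
    (hg₁ : (6 * 2 ^ v * (11 * 13 * 37)) ^ 3 < 6 * (e₁ * (13 ^ 2 * 37 ^ 2)) ^ 3)
    (hg₂ : (6 * 2 ^ v * (11 * 13 * 37)) ^ 3 < 6 * (e₂ * (11 ^ 2 * 37 ^ 2)) ^ 3)
    (hg₃ : (6 * 2 ^ v * (11 * 13 * 37)) ^ 3 < 6 * (e₃ * (11 ^ 2 * 13 ^ 2)) ^ 3)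
    (hb₁ : e₁ * (13 ^ 2 * 37 ^ 2) ≡ 2 ^ b₁ [MOD 11])
    (hb₂ : e₂ * (11 ^ 2 * 37 ^ 2) ≡ 2 ^ b₂ [MOD 13])
    (hb₃ : e₃ * (11 ^ 2 * 13 ^ 2) ≡ 2 ^ b₃ [MOD 37]) :
    ∀ᶠ N : ℕ in atTop, ∀ (c₁ c₂ c₃ : ℤ) (η₁ η₂ η₃ : ℕ), IsGoodPair 11 N c₁ (2 ^ η₁) →
      IsGoodPair 13 N c₂ (2 ^ η₂) → IsGoodPair 37 N c₃ (2 ^ η₃) →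
      Even (b₁ + b₃ + (η₁ + η₃)) → Even (b₂ + b₃ + (η₂ + η₃)) → IsSumSevenTet N := by
  filter_upwards [eventually_isSumSevenTet_of_triple isLiftPrime_eleven isLiftPrime_thirteen
    isLiftPrime_thirty_seven (by norm_num) (by norm_num) (by norm_num) hform hr he₁ he₂ he₃ hg₁
    hg₂ hg₃] with N hN c₁ c₂ c₃ η₁ η₂ η₃ h₁ h₂ h₃ h₁₃ h₂₃
  obtain ⟨l, x, hx₁, hx₂, hx₃⟩ := exists_add_modEq_triple h₁₃ h₂₃
  exact hN l x _ _ _ _ _ _ h₁ h₂ h₃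
    (dvd_two_pow_mul_sub_two_pow (by norm_num) (by norm_num) (by decide) hb₁ hx₁)
    (dvd_two_pow_mul_sub_two_pow (by norm_num) (by norm_num) (by decide) hb₂ hx₂)
    (dvd_two_pow_mul_sub_two_pow (by norm_num) (by norm_num) (by decide) hb₃ hx₃)

theorem eventually_of_triple : ∀ᶠ N : ℕ in atTop, ∀ (c₁ c₂ c₃ : ℤ) (η₁ η₂ η₃ : ℕ),
    IsGoodPair 11 N c₁ (2 ^ η₁) → IsGoodPair 13 N c₂ (2 ^ η₂) → IsGoodPair 37 N c₃ (2 ^ η₃) →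
    IsSumSevenTet N := by
  filter_upwards [
    eventually_of_parity (v := 1) (b₁ := 7) (b₂ := 4) (b₃ := 12)
      representsClass_one_two_four.swap₁₂ (by norm_num) (by norm_num) (by norm_num)
      (by norm_num) (by norm_num) (by norm_num) (by norm_num) (by decide) (by decide) (by decide),
    eventually_of_parity (v := 1) (b₁ := 6) (b₂ := 5) (b₃ := 12)
      representsClass_one_two_four (by norm_num) (by norm_num) (by norm_num)
      (by norm_num) (by norm_num) (by norm_num) (by norm_num) (by decide) (by decide) (by decide),
    eventually_of_parity (v := 1) (b₁ := 6) (b₂ := 6) (b₃ := 11)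
      representsClass_one_two_four.swap₂₃ (by norm_num) (by norm_num) (by norm_num)
      (by norm_num) (by norm_num) (by norm_num) (by norm_num) (by decide) (by decide) (by decide),
    eventually_of_parity (v := 2) (b₁ := 6) (b₂ := 4) (b₃ := 12)
      representsClass_one_one_four (by norm_num) (by norm_num) (by norm_num)
      (by norm_num) (by norm_num) (by norm_num) (by norm_num) (by decide) (by decide) (by decide)]
    with N hN₁ hN₂ hN₃ hN c₁ c₂ c₃ η₁ η₂ η₃ h₁ h₂ h₃
  simp only [Nat.even_iff] at hN₁ hN₂ hN₃ hN
  have h : ((η₁ + η₃) % 2 = 1 ∧ (η₂ + η₃) % 2 = 0) ∨ ((η₁ + η₃) % 2 = 0 ∧ (η₂ + η₃) % 2 = 1) ∨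
      ((η₁ + η₃) % 2 = 1 ∧ (η₂ + η₃) % 2 = 1) ∨ ((η₁ + η₃) % 2 = 0 ∧ (η₂ + η₃) % 2 = 0) := by
    omega
  rcases h with h | h | h | h
  · exact hN₁ _ _ _ _ _ _ h₁ h₂ h₃ (by omega) (by omega)
  · exact hN₂ _ _ _ _ _ _ h₁ h₂ h₃ (by omega) (by omega)
  · exact hN₃ _ _ _ _ _ _ h₁ h₂ h₃ (by omega) (by omega)
  · exact hN _ _ _ _ _ _ h₁ h₂ h₃ (by omega) (by omega)

theorem eventually_isSumSevenTet_natCast : ∀ᶠ N : ℕ in atTop, IsSumSevenTet N := by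
  filter_upwards [eventually_of_eleven_dvd (s := 13) (by norm_num) (by norm_num) (by norm_num),
    eventually_of_eleven_dvd (s := 37) (by norm_num) (by norm_num) (by norm_num),
    eventually_of_thirteen_dvd (s := 37) (by norm_num) (by norm_num) (by norm_num),
    eventually_of_thirteen_dvd (s := 7) (by norm_num) (by norm_num) (by norm_num),
    eventually_of_eleven, eventually_of_thirteen_of_odd_add, eventually_of_thirteen_of_even_add,
    eventually_of_thirty_seven, eventually_of_triple]
    with N h_11_13 h_11_37 h_13_37 h_13_7 h_11 h_13_odd h_13_even h_37 h_triple
  rcases dvd_or_exists_isGoodPair_eleven N with d₁ | ⟨c₁, η₁, g₁⟩ <;>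
  rcases dvd_or_exists_isGoodPair_thirteen N with d₂ | ⟨c₂, η₂, g₂⟩
  · exact h_11_13 d₁ (hasSimpleRoot_of_dvd (by norm_num) d₂)
  · rcases hasSimpleRoot_or_exists_isGoodPair_thirty_seven N with r | ⟨c₃, η₃, g₃⟩
    · exact h_11_37 d₁ r
    · exact h_11 _ _ _ _ (hasSimpleRoot_of_dvd (by norm_num) d₁) g₂ g₃
  · rcases hasSimpleRoot_or_exists_isGoodPair_thirty_seven N with r | ⟨c₃, η₃, g₃⟩
    · exact h_13_37 d₂ r
    have r₂ : HasSimpleRoot 13 N := hasSimpleRoot_of_dvd (by norm_num) d₂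
    rcases Nat.even_or_odd (η₁ + η₃) with h | h
    · rcases hasSimpleRoot_seven_or N with r | ⟨ε, -, hε⟩
      · exact h_13_7 d₂ r
      · exact h_13_even _ _ _ _ _ r₂ g₁ g₃ h hε
    · exact h_13_odd _ _ _ _ r₂ g₁ g₃ h
  · rcases hasSimpleRoot_or_exists_isGoodPair_thirty_seven N with r | ⟨c₃, η₃, g₃⟩
    · exact h_37 _ _ _ _ r g₁ g₂
    · exact h_triple _ _ _ _ _ _ g₁ g₂ g₃

theorem stmt_9 :
    ∃ N₀ : ℕ, ∀ N : ℕ, N₀ ≤ N →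
      ∃ l : List ℕ, l.length ≤ 7 ∧ (∀ n ∈ l, 3 ≤ n) ∧
        N = (l.map (fun n => n.choose 3)).sum := by
  obtain ⟨N₀, h⟩ := eventually_atTop.mp eventually_isSumSevenTet_natCast
  exact ⟨N₀, fun N hN => (h N hN).exists_list⟩
end
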